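/- Let N ≥ 3, p ∈ (1,p_N) with p_N = N/(N−2), and let Ω = D_N be the ball of unit volume in R^N with radius R_N. Then for every I > 0 (equivalently every λ > 0) there exists a unique solution of the free boundary problem (F)_I (equivalently of (P)_λ), say v with boundary value γ = v|_{∂D_N}. Setting I*(D_N,p) = I_p / R_N^{(N/(p−1))(1−p/p_N)} and λ*(D_N,p) = I*(D_N,p)^{(p−1)/p}, the solution is positive (γ > 0) if and only if I < I*(D_N,p), equivalently λ < λ*(D_N,p); the free boundary is nonempty (γ < 0) if and only if I > I*(D_N,p), equivalently λ > λ*(D_N,p). Moreover, in the variables (α_λ,ψ_λ), α_λ = c_N λ (1 − (λ/λ*(D_N,p))^{p/(p_N−p)}) for all λ > λ*(D_N,p), where c_N = (N(N−2)ω_N R_N^{N−2})^{−1}. -/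

import Mathlib

open MeasureTheory Metric Filter Real Set
noncomputable section

/-- The Laplacian of `f : ℝᴺ → ℝ` as the sum of second partial derivatives. -/
def lap {N : ℕ} (f : EuclideanSpace ℝ (Fin N) → ℝ) (x : EuclideanSpace ℝ (Fin N)) : ℝ :=
  ∑ i : Fin N, fderiv ℝ (fun y => fderiv ℝ f y (EuclideanSpace.single i 1)) x
    (EuclideanSpace.single i 1)

/-- `ω_N`, the volume of the unit ball of `ℝᴺ`. -/
def omegaN (N : ℕ) : ℝ := (volume (ball (0 : EuclideanSpace ℝ (Fin N)) 1)).toReal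

/-- `R_N`, the radius of the ball of unit volume in `ℝᴺ`. -/
def RN (N : ℕ) : ℝ := omegaN N ^ (-(1 : ℝ) / N)

/-- `(α, ψ)` is a solution of the problem `(P)_λ` on `Ω`. -/
structure IsSol {N : ℕ} (Ω : Set (EuclideanSpace ℝ (Fin N))) (p lam α : ℝ)
    (ψ : EuclideanSpace ℝ (Fin N) → ℝ) : Prop where
  contOn : ContinuousOn ψ (closure Ω)
  smooth : ContDiffOn ℝ 2 ψ Ω
  pde : ∀ x ∈ Ω, -lap ψ x = max (α + lam * ψ x) 0 ^ p
  bdry : ∀ x ∈ frontier Ω, ψ x = 0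
  constr : ∫ x in Ω, max (α + lam * ψ x) 0 ^ p = 1

/-- `(γ, v)` is a solution of the free boundary problem `(F)_I` on `Ω`:
`-Δv = [v]₊ᵖ` in `Ω`, `v = γ` on `∂Ω`, `∫_Ω [v]₊ᵖ = I`. -/
structure IsFBSol {N : ℕ} (Ω : Set (EuclideanSpace ℝ (Fin N))) (p I γ : ℝ)
    (v : EuclideanSpace ℝ (Fin N) → ℝ) : Prop where
  contOn : ContinuousOn v (closure Ω)
  smooth : ContDiffOn ℝ 2 v Ω
  pde : ∀ x ∈ Ω, -lap v x = max (v x) 0 ^ p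
  bdry : ∀ x ∈ frontier Ω, v x = γ
  constr : ∫ x in Ω, max (v x) 0 ^ p = I

/-- `g` is the radial profile of the unique positive solution of the Emden problem
`-Δu = uᵖ` on the unit ball `B₁(0) ⊂ ℝᴺ`, `u = 0` on `∂B₁(0)`. -/
structure IsEmdenProfile (N : ℕ) (p : ℝ) (g : ℝ → ℝ) : Prop where
  smooth : ContDiffOn ℝ 2 (fun x : EuclideanSpace ℝ (Fin N) => g ‖x‖) (ball 0 1)
  contOn : ContinuousOn (fun x : EuclideanSpace ℝ (Fin N) => g ‖x‖) (closedBall 0 1)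
  pde : ∀ x ∈ ball (0 : EuclideanSpace ℝ (Fin N)) 1,
    -lap (fun y : EuclideanSpace ℝ (Fin N) => g ‖y‖) x = g ‖x‖ ^ p
  pos : ∀ x ∈ ball (0 : EuclideanSpace ℝ (Fin N)) 1, 0 < g ‖x‖
  bdry : g 1 = 0
  diff : DifferentiableAt ℝ g 1
  dneg : deriv g 1 < 0

/-- `I_p = ∫_{B₁} uᵖ = Nω_N(-u'(1))`. -/
def Ipval (N : ℕ) (g : ℝ → ℝ) : ℝ := (N : ℝ) * omegaN N * (-(deriv g 1))

/-- `I*(𝔻_N,p) = I_p / R_N^{(N/(p-1))(1-p/p_N)}`. -/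
def Istar (N : ℕ) (p : ℝ) (g : ℝ → ℝ) : ℝ :=
  Ipval N g / RN N ^ ((N : ℝ) / (p - 1) * (1 - p * ((N : ℝ) - 2) / N))

/-- `λ*(𝔻_N,p) = I*(𝔻_N,p)^{(p-1)/p}`. -/
def lamStarBall (N : ℕ) (p : ℝ) (g : ℝ → ℝ) : ℝ := Istar N p g ^ ((p - 1) / p)

/-- `c_N = (N(N-2)ω_N R_N^{N-2})⁻¹`. -/
def cN (N : ℕ) : ℝ :=
  ((N : ℝ) * ((N : ℝ) - 2) * omegaN N * RN N ^ ((N : ℝ) - 2))⁻¹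

/-! ### The Laplacian -/

lemma lap_congr {N : ℕ} {f h : EuclideanSpace ℝ (Fin N) → ℝ} {x : EuclideanSpace ℝ (Fin N)}
    (hfh : f =ᶠ[nhds x] h) : lap f x = lap h x := by
  unfold lap
  refine Finset.sum_congr rfl fun i _ => ?_
  have : (fun y => fderiv ℝ f y (EuclideanSpace.single i 1)) =ᶠ[nhds x]
      fun y => fderiv ℝ h y (EuclideanSpace.single i 1) := by
    filter_upwards [hfh.fderiv (𝕜 := ℝ)] with y hy
    rw [hy]
  rw [this.fderiv_eq]

lemma lap_eq_sum {N : ℕ} {f : EuclideanSpace ℝ (Fin N) → ℝ} {x : EuclideanSpace ℝ (Fin N)}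
    {f' : EuclideanSpace ℝ (Fin N) → EuclideanSpace ℝ (Fin N) →L[ℝ] ℝ}
    (hf : ∀ᶠ y in nhds x, HasFDerivAt f (f' y) y)
    {D : Fin N → EuclideanSpace ℝ (Fin N) →L[ℝ] ℝ}
    (hD : ∀ i, HasFDerivAt (fun y => f' y (EuclideanSpace.single i 1)) (D i) x) :
    lap f x = ∑ i, D i (EuclideanSpace.single i 1) := by
  unfold lap
  refine Finset.sum_congr rfl fun i _ => ?_
  have : (fun y => fderiv ℝ f y (EuclideanSpace.single i 1)) =ᶠ[nhds x]
      fun y => f' y (EuclideanSpace.single i 1) := by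
    filter_upwards [hf] with y hy
    rw [hy.fderiv]
  rw [this.fderiv_eq, (hD i).fderiv]

lemma lap_eq_iteratedFDeriv {N : ℕ} {f : EuclideanSpace ℝ (Fin N) → ℝ}
    {x : EuclideanSpace ℝ (Fin N)} (hf : ContDiffAt ℝ 2 f x) :
    lap f x = ∑ i : Fin N, iteratedFDeriv ℝ 2 f x
      ![EuclideanSpace.single i 1, EuclideanSpace.single i 1] := by
  have hd : DifferentiableAt ℝ (fderiv ℝ f) x :=
    (hf.fderiv_right (m := 1) (by norm_num)).differentiableAt (by norm_num)
  unfold lap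
  refine Finset.sum_congr rfl fun i _ => ?_
  rw [iteratedFDeriv_two_apply, fderiv_clm_apply hd (differentiableAt_const _)]
  simp

lemma lap_eq_laplacian {N : ℕ} {f : EuclideanSpace ℝ (Fin N) → ℝ}
    {x : EuclideanSpace ℝ (Fin N)} (hf : ContDiffAt ℝ 2 f x) :
    lap f x = Laplacian.laplacian f x := by
  rw [lap_eq_iteratedFDeriv hf,
    InnerProductSpace.laplacian_eq_iteratedFDeriv_orthonormalBasis f
      (EuclideanSpace.basisFun (Fin N) ℝ)]
  simp

lemma lap_add {N : ℕ} {f h : EuclideanSpace ℝ (Fin N) → ℝ} {x : EuclideanSpace ℝ (Fin N)}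
    (hf : ContDiffAt ℝ 2 f x) (hh : ContDiffAt ℝ 2 h x) :
    lap (fun y => f y + h y) x = lap f x + lap h x := by
  rw [lap_eq_laplacian hf, lap_eq_laplacian hh, lap_eq_laplacian (hf.add hh)]
  exact hf.laplacian_add hh

lemma lap_sub {N : ℕ} {f h : EuclideanSpace ℝ (Fin N) → ℝ} {x : EuclideanSpace ℝ (Fin N)}
    (hf : ContDiffAt ℝ 2 f x) (hh : ContDiffAt ℝ 2 h x) :
    lap (fun y => f y - h y) x = lap f x - lap h x := by
  rw [lap_eq_laplacian hf, lap_eq_laplacian hh, lap_eq_laplacian (hf.sub hh)]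
  exact hf.laplacian_sub hh

lemma lap_const_mul {N : ℕ} {f : EuclideanSpace ℝ (Fin N) → ℝ} {x : EuclideanSpace ℝ (Fin N)}
    (c : ℝ) (hf : ContDiffAt ℝ 2 f x) :
    lap (fun y => c * f y) x = c * lap f x := by
  rw [lap_eq_laplacian hf, lap_eq_laplacian (contDiffAt_const.mul hf)]
  exact InnerProductSpace.laplacian_smul c hf

lemma lap_const {N : ℕ} (c : ℝ) (x : EuclideanSpace ℝ (Fin N)) :
    lap (fun _ : EuclideanSpace ℝ (Fin N) => c) x = 0 := by
  simp [lap]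

lemma lap_comp_isometry {N : ℕ} {f : EuclideanSpace ℝ (Fin N) → ℝ}
    {x c : EuclideanSpace ℝ (Fin N)}
    (A : EuclideanSpace ℝ (Fin N) ≃ₗᵢ[ℝ] EuclideanSpace ℝ (Fin N))
    (hf : ContDiffAt ℝ 2 f (c + A x)) :
    lap (fun y => f (c + A y)) x = lap f (c + A x) := by
  have h1 : ContDiffAt ℝ 2 (fun y => f (c + y)) (A x) := by
    have : ContDiffAt ℝ 2 (fun y => c + y) (A x) := by fun_prop
    exact ContDiffAt.comp (A x) (g := f) (f := fun y => c + y) hf this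
  have h2 : ContDiffAt ℝ 2 (fun y => f (c + A y)) x := by
    have : ContDiffAt ℝ 2 (fun y => c + A y) x := by fun_prop
    exact ContDiffAt.comp x (g := f) (f := fun y => c + A y) hf this
  rw [lap_eq_iteratedFDeriv h2, lap_eq_laplacian hf,
    InnerProductSpace.laplacian_eq_iteratedFDeriv_orthonormalBasis f
      ((EuclideanSpace.basisFun (Fin N) ℝ).map A)]
  refine Finset.sum_congr rfl fun i _ => ?_
  have h3 := A.toContinuousLinearEquiv.iteratedFDerivWithin_comp_right
    (fun y => f (c + y)) uniqueDiffOn_univ (x := x) (mem_univ _) 2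
  rw [preimage_univ, iteratedFDerivWithin_univ, iteratedFDerivWithin_univ] at h3
  have h4 : (fun y => f (c + A y)) = (fun y => f (c + y)) ∘ A.toContinuousLinearEquiv := rfl
  rw [h4, h3, iteratedFDeriv_comp_add_left]
  simp only [ContinuousMultilinearMap.compContinuousLinearMap_apply]
  congr 1
  ext j
  fin_cases j <;> simp

lemma lap_comp_smul {N : ℕ} {f : EuclideanSpace ℝ (Fin N) → ℝ}
    {x : EuclideanSpace ℝ (Fin N)} (m : ℝ) (hf : ContDiff ℝ 2 f) :
    lap (fun y => f (m • y)) x = m ^ 2 * lap f (m • x) := by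
  have h2 : ContDiff ℝ 2 (fun y => f (m • y)) := hf.comp (contDiff_const_smul m)
  rw [lap_eq_iteratedFDeriv h2.contDiffAt, lap_eq_iteratedFDeriv hf.contDiffAt, Finset.mul_sum]
  refine Finset.sum_congr rfl fun i _ => ?_
  have h5 := iteratedFDeriv_comp_const_smul (𝕜 := ℝ) (i := 2) m hf
  rw [h5]
  simp

lemma lap_nonneg_of_isLocalMin {N : ℕ} {f : EuclideanSpace ℝ (Fin N) → ℝ}
    {x : EuclideanSpace ℝ (Fin N)} (hf : ContDiffAt ℝ 2 f x) (hm : IsLocalMin f x) :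
    0 ≤ lap f x := by
  unfold lap
  refine Finset.sum_nonneg fun i _ => ?_
  set e : EuclideanSpace ℝ (Fin N) := EuclideanSpace.single i 1
  set k : ℝ → ℝ := fun t => f (x + t • e) with hk
  have hl : ∀ t : ℝ, HasDerivAt (fun t : ℝ => x + t • e) e t := fun t => by
    simpa using ((hasDerivAt_id t).smul_const e).const_add x
  have hc : ContinuousAt (fun t : ℝ => x + t • e) 0 := (hl 0).continuousAt
  have hc' : Tendsto (fun t : ℝ => x + t • e) (nhds 0) (nhds x) := by
    simpa [ContinuousAt] using hc
  have hdf : ∀ᶠ y in nhds x, DifferentiableAt ℝ f y := by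
    filter_upwards [hf.eventually (by simp)] with y hy
    exact hy.differentiableAt (by norm_num)
  have hd1 : deriv k =ᶠ[nhds 0] fun t => fderiv ℝ f (x + t • e) e := by
    filter_upwards [hc'.eventually hdf] with t ht
    exact (ht.hasFDerivAt.comp_hasDerivAt t (hl t)).deriv
  have hd : DifferentiableAt ℝ (fun y => fderiv ℝ f y e) x :=
    ((hf.fderiv_right (m := 1) (by norm_num)).differentiableAt (by norm_num)).clm_apply
      (differentiableAt_const _)
  have hd2 : deriv (deriv k) 0 = fderiv ℝ (fun y => fderiv ℝ f y e) x e := by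
    rw [hd1.deriv_eq]
    have h0 : HasFDerivAt (fun y => fderiv ℝ f y e) (fderiv ℝ (fun y => fderiv ℝ f y e) x)
        (x + (0 : ℝ) • e) := by simpa using hd.hasFDerivAt
    exact (h0.comp_hasDerivAt (0 : ℝ) (hl 0)).deriv
  have hkm : IsLocalMin k 0 := by
    have : ∀ᶠ t in nhds (0 : ℝ), f x ≤ f (x + t • e) := hc'.eventually hm
    filter_upwards [this] with t ht
    simpa [hk] using ht
  rw [← hd2]
  by_contra! hneg
  have hmax := isLocalMax_of_deriv_deriv_neg hneg hkm.deriv_eq_zero (by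
    have : ContinuousAt f (x + (0 : ℝ) • e) := by simpa using hf.continuousAt
    exact ContinuousAt.comp (f := fun t : ℝ => x + t • e) (g := f) this hc)
  have hconst : k =ᶠ[nhds 0] fun _ => k 0 := by
    filter_upwards [hkm, hmax] with t h1 h2
    exact le_antisymm h2 h1
  have h3 : deriv k =ᶠ[nhds 0] fun _ => 0 := by
    filter_upwards [hconst.eventuallyEq_nhds] with t ht
    rw [ht.deriv_eq]; simp
  rw [h3.deriv_eq] at hneg
  simp at hneg

lemma lap_comp_norm_sq {N : ℕ} {x c : EuclideanSpace ℝ (Fin N)} {φ φ' : ℝ → ℝ} {φ'' : ℝ}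
    (h1 : ∀ᶠ s in nhds (‖x - c‖ ^ 2), HasDerivAt φ (φ' s) s)
    (h2 : HasDerivAt φ' φ'' (‖x - c‖ ^ 2)) :
    lap (fun y => φ (‖y - c‖ ^ 2)) x =
      4 * ‖x - c‖ ^ 2 * φ'' + 2 * N * φ' (‖x - c‖ ^ 2) := by
  have hq : ∀ y : EuclideanSpace ℝ (Fin N),
      HasFDerivAt (fun y => ‖y - c‖ ^ 2) (2 • innerSL ℝ (y - c)) y := fun y => by
    exact (hasStrictFDerivAt_norm_sq (y - c)).hasFDerivAt.comp y
      ((hasFDerivAt_id y).sub_const c)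
  have ht : Tendsto (fun y : EuclideanSpace ℝ (Fin N) => ‖y - c‖ ^ 2) (nhds x)
      (nhds (‖x - c‖ ^ 2)) := (hq x).continuousAt
  have hf : ∀ᶠ y in nhds x, HasFDerivAt (fun y => φ (‖y - c‖ ^ 2))
      (φ' (‖y - c‖ ^ 2) • (2 • innerSL ℝ (y - c))) y := by
    filter_upwards [ht.eventually h1] with y hy
    exact hy.comp_hasFDerivAt y (hq y)
  have happ : ∀ (y : EuclideanSpace ℝ (Fin N)) (i : Fin N),
      (φ' (‖y - c‖ ^ 2) • (2 • innerSL ℝ (y - c))) (EuclideanSpace.single i 1) =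
      φ' (‖y - c‖ ^ 2) * (2 * (y i - c i)) := by
    intro y i
    simp [EuclideanSpace.inner_single_right]
  have hcoord : ∀ i : Fin N, HasFDerivAt (fun y : EuclideanSpace ℝ (Fin N) => 2 * (y i - c i))
      ((2 : ℝ) • (EuclideanSpace.proj i : EuclideanSpace ℝ (Fin N) →L[ℝ] ℝ)) x := fun i => by
    have h : HasFDerivAt (fun y : EuclideanSpace ℝ (Fin N) => y i)
      (EuclideanSpace.proj i : EuclideanSpace ℝ (Fin N) →L[ℝ] ℝ) x :=
      (EuclideanSpace.proj i : EuclideanSpace ℝ (Fin N) →L[ℝ] ℝ).hasFDerivAt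
    exact (h.sub_const (c i)).const_mul 2
  have hD : ∀ i, HasFDerivAt (fun y => (φ' (‖y - c‖ ^ 2) • (2 • innerSL ℝ (y - c)))
      (EuclideanSpace.single i 1))
      (φ' (‖x - c‖ ^ 2) • ((2 : ℝ) • (EuclideanSpace.proj i : EuclideanSpace ℝ (Fin N) →L[ℝ] ℝ))
        + (2 * (x i - c i)) • (φ'' • (2 • innerSL ℝ (x - c)))) x := fun i => by
    simp only [happ]
    exact (h2.comp_hasFDerivAt x (hq x)).mul (hcoord i)
  rw [lap_eq_sum hf hD]
  have hn : ‖x - c‖ ^ 2 = ∑ i, (x i - c i) ^ 2 := by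
    rw [EuclideanSpace.norm_sq_eq]; simp
  have : ∀ i : Fin N, (φ' (‖x - c‖ ^ 2) • ((2 : ℝ) •
      (EuclideanSpace.proj i : EuclideanSpace ℝ (Fin N) →L[ℝ] ℝ))
        + (2 * (x i - c i)) • (φ'' • (2 • innerSL ℝ (x - c)))) (EuclideanSpace.single i 1)
      = 2 * φ' (‖x - c‖ ^ 2) + 4 * φ'' * (x i - c i) ^ 2 := by
    intro i
    simp [EuclideanSpace.inner_single_right]
    ring
  simp only [this]
  rw [Finset.sum_add_distrib, ← Finset.mul_sum, ← Finset.mul_sum, ← hn]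
  simp
  ring

lemma lap_comp_norm {N : ℕ} {x : EuclideanSpace ℝ (Fin N)} (hx : x ≠ 0)
    {φ φ' : ℝ → ℝ} {φ'' : ℝ} (h1 : ∀ᶠ s in nhds ‖x‖, HasDerivAt φ (φ' s) s)
    (h2 : HasDerivAt φ' φ'' ‖x‖) :
    lap (fun y => φ ‖y‖) x = φ'' + ((N : ℝ) - 1) / ‖x‖ * φ' ‖x‖ := by
  have hr : 0 < ‖x‖ := norm_pos_iff.2 hx
  have hsq : √(‖x‖ ^ 2) = ‖x‖ := Real.sqrt_sq hr.le
  have hs : ∀ s : ℝ, 0 < s → HasDerivAt Real.sqrt (1 / (2 * √s)) s := fun s hs =>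
    Real.hasDerivAt_sqrt hs.ne'
  have ht : Tendsto Real.sqrt (nhds (‖x‖ ^ 2)) (nhds ‖x‖) := by
    have := Real.continuous_sqrt.tendsto (‖x‖ ^ 2)
    rwa [hsq] at this
  have e1 : ∀ᶠ s in nhds (‖x - 0‖ ^ 2), HasDerivAt (fun s => φ (√s))
      ((fun s => φ' (√s) * (1 / (2 * √s))) s) s := by
    rw [sub_zero]
    filter_upwards [ht.eventually h1, eventually_gt_nhds (pow_pos hr 2)] with s h hspos
    exact h.comp s (hs s hspos)
  have e2 : HasDerivAt (fun s => φ' (√s) * (1 / (2 * √s)))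
      (φ'' * (1 / (2 * ‖x‖)) * (1 / (2 * ‖x‖)) +
        φ' ‖x‖ * (-(2 * (1 / (2 * ‖x‖))) / (2 * ‖x‖) ^ 2)) (‖x - 0‖ ^ 2) := by
    rw [sub_zero]
    have hs' := hs (‖x‖ ^ 2) (pow_pos hr 2)
    have h2' : HasDerivAt φ' φ'' (√(‖x‖ ^ 2)) := by rwa [hsq]
    have a := h2'.comp (‖x‖ ^ 2) hs'
    have b := (hs'.const_mul 2).inv (by rw [hsq]; positivity)
    have := a.mul b
    simp only [hsq, Function.comp_def] at this
    refine (this.congr_deriv ?_).congr_of_eventuallyEq ?_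
    · simp
    · exact Eventually.of_forall fun s => by simp
  have := lap_comp_norm_sq e1 e2
  simp only [sub_zero, Real.sqrt_sq (norm_nonneg _)] at this
  rw [this]
  field_simp
  ring
/-! ### Maximum principles -/

lemma lap_inner_sub_sq {N : ℕ} (e x : EuclideanSpace ℝ (Fin N)) (m : ℝ) :
    lap (fun y => (inner ℝ e y - m) ^ 2) x = 2 * ‖e‖ ^ 2 := by
  have hl : ∀ y : EuclideanSpace ℝ (Fin N),
      HasFDerivAt (fun y => inner ℝ e y - m) (innerSL ℝ e) y := fun y =>
    (innerSL ℝ e).hasFDerivAt.sub_const m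
  have hf : ∀ᶠ y in nhds x, HasFDerivAt (fun y => (inner ℝ e y - m) ^ 2)
      ((2 * (inner ℝ e y - m)) • innerSL ℝ e) y := Eventually.of_forall fun y => by
    simpa using (hl y).pow 2
  have hD : ∀ i : Fin N, HasFDerivAt (fun y => ((2 * (inner ℝ e y - m)) • innerSL ℝ e)
      (EuclideanSpace.single i 1)) ((e i) • ((2 : ℝ) • innerSL ℝ e)) x := fun i => by
    have := ((hl x).const_mul 2).mul_const (e i)
    refine this.congr_of_eventuallyEq (Eventually.of_forall fun y => ?_)
    simp [EuclideanSpace.inner_single_right]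
  rw [lap_eq_sum hf hD, EuclideanSpace.norm_sq_eq, Finset.mul_sum]
  refine Finset.sum_congr rfl fun i _ => ?_
  simp [EuclideanSpace.inner_single_right]
  ring

/-- A comparison principle: in the presence of a positive strict supersolution `h` of
`Δ + L`, a function which is nonnegative off `U` and satisfies `Δz + Lz ≤ 0` where it is
negative must be nonnegative. -/
lemma nonneg_of_barrier {N : ℕ} {K U : Set (EuclideanSpace ℝ (Fin N))}
    {z h : EuclideanSpace ℝ (Fin N) → ℝ} {L : ℝ}
    (hK : IsCompact K) (hU : IsOpen U) (hUK : U ⊆ K)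
    (hz : ContinuousOn z K) (hh : ContinuousOn h K) (hpos : ∀ x ∈ K, 0 < h x)
    (hz2 : ∀ x ∈ U, ContDiffAt ℝ 2 z x) (hh2 : ∀ x ∈ U, ContDiffAt ℝ 2 h x)
    (hbd : ∀ x ∈ K, x ∉ U → 0 ≤ z x)
    (hlz : ∀ x ∈ U, z x < 0 → lap z x ≤ -L * z x)
    (hlh : ∀ x ∈ U, lap h x + L * h x < 0) :
    ∀ x ∈ K, 0 ≤ z x := by
  by_contra! hneg
  obtain ⟨y, hyK, hy⟩ := hneg
  obtain ⟨x, hxK, hx⟩ := hK.exists_isMinOn ⟨y, hyK⟩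
    (hz.div hh fun x hx => (hpos x hx).ne')
  set t : ℝ := -(z x / h x) with ht
  have hzx : z x / h x ≤ z y / h y := hx hyK
  have htpos : 0 < t := by
    have : z y / h y < 0 := div_neg_of_neg_of_pos hy (hpos y hyK)
    linarith
  have hxh := hpos x hxK
  have hzt : z x = -(t * h x) := by rw [ht]; field_simp
  have hzneg : z x < 0 := by rw [hzt]; have := mul_pos htpos hxh; linarith
  have hxU : x ∈ U := by
    by_contra hxU
    linarith [hbd x hxK hxU]
  have hmin : IsLocalMin (fun y => z y + t * h y) x := by
    filter_upwards [hU.mem_nhds hxU] with w hw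
    have hwK := hUK hw
    have h1 : z x / h x ≤ z w / h w := hx hwK
    rw [le_div_iff₀ (hpos w hwK)] at h1
    have h2 : z x / h x = -t := by rw [ht]; ring
    rw [h2] at h1
    linarith
  have hc : ContDiffAt ℝ 2 (fun y => t * h y) x := contDiffAt_const.mul (hh2 x hxU)
  have h3 := lap_nonneg_of_isLocalMin ((hz2 x hxU).add hc) hmin
  rw [lap_add (hz2 x hxU) hc, lap_const_mul t (hh2 x hxU)] at h3
  have h4 := hlz x hxU hzneg
  have h5 := mul_lt_mul_of_pos_left (hlh x hxU) htpos
  rw [hzt] at h4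
  nlinarith

lemma lap_norm_sub_sq {N : ℕ} (x c : EuclideanSpace ℝ (Fin N)) :
    lap (fun y => ‖y - c‖ ^ 2) x = 2 * N := by
  have := lap_comp_norm_sq (x := x) (c := c) (φ := fun s => s) (φ' := fun _ => 1) (φ'' := 0)
    (Eventually.of_forall fun s => hasDerivAt_id s) (hasDerivAt_const _ _)
  simpa using this

/-- Weak minimum principle for superharmonic functions. -/
lemma nonneg_of_superharmonic {N : ℕ} (hN : 0 < N) {K U : Set (EuclideanSpace ℝ (Fin N))}
    {z : EuclideanSpace ℝ (Fin N) → ℝ}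
    (hK : IsCompact K) (hU : IsOpen U) (hUK : U ⊆ K)
    (hz : ContinuousOn z K) (hz2 : ∀ x ∈ U, ContDiffAt ℝ 2 z x)
    (hbd : ∀ x ∈ K, x ∉ U → 0 ≤ z x) (hlz : ∀ x ∈ U, lap z x ≤ 0) :
    ∀ x ∈ K, 0 ≤ z x := by
  obtain ⟨C, hC⟩ := hK.isBounded.exists_norm_le
  have hcd : ∀ x : EuclideanSpace ℝ (Fin N),
      ContDiffAt ℝ 2 (fun y : EuclideanSpace ℝ (Fin N) => ‖y - 0‖ ^ 2) x := fun x => by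
    have : ContDiff ℝ 2 (fun y : EuclideanSpace ℝ (Fin N) => ‖y - 0‖ ^ 2) :=
      (contDiff_id.sub contDiff_const).norm_sq ℝ
    exact this.contDiffAt
  refine nonneg_of_barrier (h := fun y => (C ^ 2 + 1) - ‖y - 0‖ ^ 2) (L := 0) hK hU hUK hz
    (by fun_prop) ?_ hz2 (fun x _ => contDiffAt_const.sub (hcd x)) hbd
    (fun x hx _ => by simpa using hlz x hx) ?_
  · intro x hx
    have h1 := hC x hx
    have h2 := norm_nonneg x
    simp only [sub_zero]
    nlinarith
  · intro x _
    rw [lap_sub contDiffAt_const (hcd x), lap_norm_sub_sq, lap_const]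
    have : (0 : ℝ) < N := by exact_mod_cast hN
    linarith

/-- Strong minimum principle for superharmonic functions. -/
lemma pos_of_superharmonic {N : ℕ} (hN : 0 < N) {U : Set (EuclideanSpace ℝ (Fin N))}
    {z : EuclideanSpace ℝ (Fin N) → ℝ} (hU : IsOpen U) (hUc : IsPreconnected U)
    (hz2 : ∀ x ∈ U, ContDiffAt ℝ 2 z x) (hnn : ∀ x ∈ U, 0 ≤ z x)
    (hlz : ∀ x ∈ U, lap z x ≤ 0) (hex : ∃ x ∈ U, 0 < z x) :
    ∀ x ∈ U, 0 < z x := by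
  have hzc : ContinuousOn z U := fun x hx => (hz2 x hx).continuousAt.continuousWithinAt
  set S : Set (EuclideanSpace ℝ (Fin N)) := U ∩ z ⁻¹' Ioi 0 with hS
  have hSo : IsOpen S := hzc.isOpen_inter_preimage hU isOpen_Ioi
  suffices h : U ⊆ S from fun x hx => (h hx).2
  refine hUc.subset_of_closure_inter_subset hSo ?_ ?_
  · obtain ⟨x, hx, hzx⟩ := hex
    exact ⟨x, hx, hx, hzx⟩
  rintro x ⟨hxS, hxU⟩
  refine ⟨hxU, ?_⟩
  obtain ⟨r₀, hr₀, hball⟩ := Metric.isOpen_iff.1 hU x hxU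
  set r := r₀ / 3 with hr
  have hrpos : 0 < r := by positivity
  obtain ⟨y, hyS, hxy⟩ := Metric.mem_closure_iff.1 hxS r hrpos
  obtain ⟨s₀, hs₀, hsball⟩ := Metric.isOpen_iff.1 hSo y hyS
  set s := min s₀ r / 2 with hs
  have hspos : 0 < s := by have := lt_min hs₀ hrpos; positivity
  have hss₀ : s < s₀ := by have := min_le_left s₀ r; have := lt_min hs₀ hrpos; linarith
  have hsr : s < r := by have := min_le_right s₀ r; have := lt_min hs₀ hrpos; linarith
  have hsS : closedBall y s ⊆ S := (closedBall_subset_ball hss₀).trans hsball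
  have hrU : closedBall y r ⊆ U := by
    refine Subset.trans ?_ hball
    intro w hw
    rw [mem_closedBall] at hw
    rw [mem_ball]
    calc dist w x ≤ dist w y + dist y x := dist_triangle _ _ _
      _ < r₀ := by rw [dist_comm y x]; linarith
  obtain ⟨w, hwm, hwmin⟩ := (isCompact_closedBall y s).exists_isMinOn
    ⟨y, mem_closedBall_self hspos.le⟩ (hzc.mono (hsS.trans inter_subset_left))
  set m := z w with hm
  have hmpos : 0 < m := (hsS hwm).2
  set a : ℝ := N / (2 * s ^ 2) with ha
  have hNpos : (0 : ℝ) < N := by exact_mod_cast hN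
  have hapos : 0 < a := by positivity
  set φ : EuclideanSpace ℝ (Fin N) → ℝ :=
    fun u => Real.exp (-a * ‖u - y‖ ^ 2) - Real.exp (-a * r ^ 2) with hφ
  have hexp : ContDiff ℝ 2
      (fun u : EuclideanSpace ℝ (Fin N) => Real.exp (-a * ‖u - y‖ ^ 2)) :=
    (contDiff_const.mul ((contDiff_id.sub contDiff_const).norm_sq ℝ)).exp
  have hφc : ContDiff ℝ 2 φ := hexp.sub contDiff_const
  have hφl : ∀ u, s < ‖u - y‖ → 0 ≤ lap φ u := by
    intro u hu
    rw [hφ, lap_sub hexp.contDiffAt contDiffAt_const, lap_const, sub_zero]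
    have hd : ∀ t : ℝ, HasDerivAt (fun t => Real.exp (-a * t)) (-a * Real.exp (-a * t)) t :=
      fun t => by
        have := ((hasDerivAt_id t).const_mul (-a)).exp
        simpa [mul_comm] using this
    rw [lap_comp_norm_sq (φ := fun t => Real.exp (-a * t))
      (Eventually.of_forall hd) ((hd _).const_mul (-a))]
    have h1 : s ^ 2 ≤ ‖u - y‖ ^ 2 := by gcongr
    have h2 : 0 ≤ 4 * ‖u - y‖ ^ 2 * a - 2 * N := by
      have : 4 * s ^ 2 * a = 2 * N := by rw [ha]; field_simp; norm_num
      nlinarith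
    have h3 := Real.exp_pos (-a * ‖u - y‖ ^ 2)
    have : 4 * ‖u - y‖ ^ 2 * (-a * (-a * Real.exp (-a * ‖u - y‖ ^ 2))) +
      2 * N * (-a * Real.exp (-a * ‖u - y‖ ^ 2)) =
      a * Real.exp (-a * ‖u - y‖ ^ 2) * (4 * ‖u - y‖ ^ 2 * a - 2 * N) := by ring
    rw [this]
    positivity
  have hxr : x ∈ closedBall y r := by rw [mem_closedBall]; exact hxy.le
  by_cases hxs : x ∈ closedBall y s
  · exact (hsS hxs).2
  have key := nonneg_of_superharmonic hN (K := closedBall y r \ ball y s)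
    (U := ball y r \ closedBall y s) (z := fun u => z u - m * φ u)
    ((isCompact_closedBall y r).diff isOpen_ball) (isOpen_ball.sdiff isClosed_closedBall)
    (sdiff_subset_sdiff ball_subset_closedBall ball_subset_closedBall)
    ((hzc.mono (sdiff_subset.trans hrU)).sub (hφc.continuous.continuousOn.const_smul m))
    (fun u hu => (hz2 u (hrU (ball_subset_closedBall hu.1))).sub
      (contDiffAt_const.mul hφc.contDiffAt)) ?_ ?_ x ⟨hxr, fun h => hxs (ball_subset_closedBall h)⟩
  · have : 0 < φ x := by
      rw [hφ]
      have h1 : ‖x - y‖ < r := by rw [← dist_eq_norm]; exact hxy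
      have : ‖x - y‖ ^ 2 < r ^ 2 := by gcongr
      have := Real.exp_lt_exp.2 (show -a * r ^ 2 < -a * ‖x - y‖ ^ 2 by nlinarith)
      simpa using this
    have := mul_pos hmpos this
    show 0 < z x
    linarith
  · rintro u ⟨hu1, hu2⟩ hu
    have hu1' := hu1
    rw [mem_closedBall, dist_eq_norm] at hu1
    by_cases hus : u ∈ closedBall y s
    · have h1 : m ≤ z u := hwmin hus
      have h2 : φ u ≤ 1 := by
        have := Real.exp_pos (-a * r ^ 2)
        have h4 : Real.exp (-a * ‖u - y‖ ^ 2) ≤ 1 :=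
          Real.exp_le_one_iff.2 (by have := sq_nonneg ‖u - y‖; nlinarith)
        simp only [hφ]
        linarith
      have : m * φ u ≤ m := by nlinarith
      linarith
    · have hur : ‖u - y‖ = r := by
        refine le_antisymm hu1 ?_
        by_contra! h
        exact hu ⟨by rw [mem_ball, dist_eq_norm]; exact h, hus⟩
      have : φ u = 0 := by simp [hφ, hur]
      rw [this]
      have := hnn u (hrU hu1')
      linarith
  · rintro u ⟨hu1, hu2⟩
    have huU := hrU (ball_subset_closedBall hu1)
    rw [lap_sub (hz2 u huU) (contDiffAt_const.mul hφc.contDiffAt),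
      lap_const_mul m hφc.contDiffAt]
    rw [mem_closedBall, dist_eq_norm, not_le] at hu2
    have := mul_nonneg hmpos.le (hφl u hu2)
    linarith [hlz u huU]
/-! ### The nonlinearity `t ↦ [t]₊ᵖ` -/

lemma posPart_rpow_nonneg (p t : ℝ) : 0 ≤ max t 0 ^ p :=
  Real.rpow_nonneg (le_max_right _ _) _

lemma posPart_rpow_mono {p : ℝ} (hp : 1 < p) {a b : ℝ} (hab : a ≤ b) :
    max a 0 ^ p ≤ max b 0 ^ p :=
  Real.rpow_le_rpow (le_max_right _ _) (max_le_max_right 0 hab) (by linarith)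

lemma continuous_posPart_rpow {p : ℝ} (hp : 1 < p) : Continuous fun t : ℝ => max t 0 ^ p :=
  (continuous_id.max continuous_const).rpow_const fun _ => Or.inr (by linarith)

lemma posPart_rpow_sub_le {p : ℝ} (hp : 1 < p) {M a b : ℝ} (hab : a ≤ b) (hb : b ≤ M) :
    max b 0 ^ p - max a 0 ^ p ≤ p * max M 0 ^ (p - 1) * (b - a) := by
  rcases le_or_gt b 0 with h | h
  · rw [max_eq_right h, max_eq_right (hab.trans h), sub_self]
    have := Real.rpow_nonneg (le_max_right M 0) (p - 1)
    have : 0 ≤ b - a := by linarith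
    positivity
  · rw [max_eq_left h.le, max_eq_left (h.le.trans hb)]
    set a' := max a 0
    have ha0 : 0 ≤ a' := le_max_right _ _
    have hba : b - a' ≤ b - a := by have := le_max_left a 0; simp only [a']; linarith
    have hab' : a' ≤ b := max_le hab h.le
    have h1 : b ^ p - a' ^ p ≤ p * b ^ (p - 1) * (b - a') := by
      have hs : -1 ≤ (a' - b) / b := by
        rw [le_div_iff₀ h]; linarith
      have h2 := one_add_mul_self_le_rpow_one_add hs hp.le
      have h3 : 1 + (a' - b) / b = a' / b := by field_simp; ring
      rw [h3, Real.div_rpow ha0 h.le, le_div_iff₀ (Real.rpow_pos_of_pos h p)] at h2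
      have h4 : b ^ p = b ^ (p - 1) * b := by
        rw [← Real.rpow_add_one h.ne']; ring_nf
      have h5 : (1 + p * ((a' - b) / b)) * b ^ p = b ^ p - p * b ^ (p - 1) * (b - a') := by
        rw [h4]; field_simp; ring
      linarith
    refine h1.trans ?_
    have h6 : b ^ (p - 1) ≤ M ^ (p - 1) := Real.rpow_le_rpow h.le hb (by linarith)
    have h7 : 0 ≤ b ^ (p - 1) := Real.rpow_nonneg h.le _
    have h8 : 0 ≤ b - a' := by linarith
    have h9 : 0 ≤ p * M ^ (p - 1) := mul_nonneg (by linarith) (h7.trans h6)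
    gcongr

/-! ### Reflections in hyperplanes -/

/-- The reflection of `x` in the hyperplane `{y | ⟪e, y⟫ = l}`, for a unit vector `e`. -/
def planeRefl {N : ℕ} (e : EuclideanSpace ℝ (Fin N)) (l : ℝ) (x : EuclideanSpace ℝ (Fin N)) :
    EuclideanSpace ℝ (Fin N) :=
  x - (2 * (inner ℝ e x - l)) • e

lemma planeRefl_eq {N : ℕ} {e : EuclideanSpace ℝ (Fin N)} (he : ‖e‖ = 1) (l : ℝ)
    (x : EuclideanSpace ℝ (Fin N)) :
    planeRefl e l x = (2 * l) • e + (Submodule.span ℝ {e})ᗮ.reflection x := by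
  rw [Submodule.reflection_orthogonal_apply, Submodule.reflection_singleton_apply]
  simp only [planeRefl, he]
  simp
  module

lemma norm_planeRefl_sq {N : ℕ} {e : EuclideanSpace ℝ (Fin N)} (he : ‖e‖ = 1) (l : ℝ)
    (x : EuclideanSpace ℝ (Fin N)) :
    ‖planeRefl e l x‖ ^ 2 = ‖x‖ ^ 2 - 4 * l * (inner ℝ e x - l) := by
  rw [planeRefl, norm_sub_sq_real, norm_smul, he, inner_smul_right, real_inner_comm,
    Real.norm_eq_abs, mul_one, sq_abs]
  ring

lemma dist_planeRefl {N : ℕ} {e : EuclideanSpace ℝ (Fin N)} (he : ‖e‖ = 1) (l m : ℝ)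
    (x : EuclideanSpace ℝ (Fin N)) :
    dist (planeRefl e l x) (planeRefl e m x) = 2 * |l - m| := by
  have : planeRefl e l x - planeRefl e m x = (2 * (l - m)) • e := by
    simp only [planeRefl]; module
  rw [dist_eq_norm, this, norm_smul, he, Real.norm_eq_abs, abs_mul]
  simp

lemma planeRefl_of_inner_eq {N : ℕ} {e x : EuclideanSpace ℝ (Fin N)} {l : ℝ}
    (h : inner ℝ e x = l) : planeRefl e l x = x := by
  simp [planeRefl, h]

lemma contDiff_planeRefl {N : ℕ} (e : EuclideanSpace ℝ (Fin N)) (l : ℝ) :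
    ContDiff ℝ 2 (planeRefl e l) := by
  unfold planeRefl
  have : ContDiff ℝ 2 (fun x : EuclideanSpace ℝ (Fin N) => inner ℝ e x) :=
    contDiff_const.inner ℝ contDiff_id
  exact contDiff_id.sub ((contDiff_const.mul (this.sub contDiff_const)).smul contDiff_const)

lemma planeRefl_mem_closedBall {N : ℕ} {e x : EuclideanSpace ℝ (Fin N)} (he : ‖e‖ = 1)
    {l R : ℝ} (hR : 0 ≤ R) (hl : 0 ≤ l) (hx : x ∈ closedBall 0 R) (hxl : l ≤ inner ℝ e x) :
    planeRefl e l x ∈ closedBall 0 R := by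
  rw [mem_closedBall_zero_iff] at hx ⊢
  refine abs_le_of_sq_le_sq' ?_ hR |>.2
  rw [norm_planeRefl_sq he]
  have h1 : ‖x‖ ^ 2 ≤ R ^ 2 := by gcongr
  have := mul_nonneg hl (sub_nonneg.2 hxl)
  linarith

lemma planeRefl_mem_ball {N : ℕ} {e x : EuclideanSpace ℝ (Fin N)} (he : ‖e‖ = 1)
    {l R : ℝ} (hR : 0 ≤ R) (hl : 0 < l) (hx : x ∈ closedBall 0 R) (hxl : l < inner ℝ e x) :
    planeRefl e l x ∈ ball 0 R := by
  rw [mem_closedBall_zero_iff] at hx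
  rw [mem_ball_zero_iff]
  refine abs_lt_of_sq_lt_sq' ?_ hR |>.2
  rw [norm_planeRefl_sq he]
  have h1 : ‖x‖ ^ 2 ≤ R ^ 2 := by gcongr
  have := mul_pos hl (sub_pos.2 hxl)
  linarith

lemma lap_comp_planeRefl {N : ℕ} {e x : EuclideanSpace ℝ (Fin N)} (he : ‖e‖ = 1) {l : ℝ}
    {v : EuclideanSpace ℝ (Fin N) → ℝ} (hv : ContDiffAt ℝ 2 v (planeRefl e l x)) :
    lap (fun y => v (planeRefl e l y)) x = lap v (planeRefl e l x) := by
  simp only [planeRefl_eq he] at hv ⊢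
  exact lap_comp_isometry _ hv
/-! ### The moving plane method on balls -/

/-- `v` solves `-Δv = [v]₊ᵖ` in the ball of radius `R`, is constant equal to `γ` on the
boundary, and is larger than `γ` inside. -/
structure BallSol {N : ℕ} (R p γ : ℝ) (v : EuclideanSpace ℝ (Fin N) → ℝ) : Prop where
  cont : ContinuousOn v (closedBall 0 R)
  smooth : ∀ x ∈ ball 0 R, ContDiffAt ℝ 2 v x
  pde : ∀ x ∈ ball 0 R, -lap v x = max (v x) 0 ^ p
  bdry : ∀ x ∈ sphere 0 R, v x = γ
  lt : ∀ x ∈ ball 0 R, γ < v x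

/-- The half-ball comparison `v ≤ v ∘ σ` on the cap cut off by the hyperplane `⟪e, x⟫ = l`. -/
def CapLe {N : ℕ} (R : ℝ) (v : EuclideanSpace ℝ (Fin N) → ℝ) (e : EuclideanSpace ℝ (Fin N))
    (l : ℝ) : Prop :=
  ∀ x ∈ closedBall 0 R, l ≤ inner ℝ e x → v x ≤ v (planeRefl e l x)

section MovingPlane

variable {N : ℕ} {R p γ : ℝ} {v : EuclideanSpace ℝ (Fin N) → ℝ} {e : EuclideanSpace ℝ (Fin N)}

lemma inner_le_of_mem_closedBall (he : ‖e‖ = 1) {x : EuclideanSpace ℝ (Fin N)}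
    (hx : x ∈ closedBall 0 R) : inner ℝ e x ≤ R := by
  rw [mem_closedBall_zero_iff] at hx
  calc inner ℝ e x ≤ ‖e‖ * ‖x‖ := real_inner_le_norm _ _
    _ ≤ R := by rw [he, one_mul]; exact hx

lemma continuous_inner_left (e : EuclideanSpace ℝ (Fin N)) :
    Continuous fun x : EuclideanSpace ℝ (Fin N) => inner ℝ e x :=
  continuous_const.inner continuous_id

lemma BallSol.contDiffAt_refl (hv : BallSol R p γ v) (hR : 0 < R) (he : ‖e‖ = 1) {l : ℝ}
    (hl : 0 < l) {x : EuclideanSpace ℝ (Fin N)} (hx : x ∈ closedBall 0 R)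
    (hlx : l < inner ℝ e x) : ContDiffAt ℝ 2 (fun y => v (planeRefl e l y)) x :=
  ContDiffAt.comp x (hv.smooth _ (planeRefl_mem_ball he hR.le hl hx hlx))
    (contDiff_planeRefl e l).contDiffAt

lemma BallSol.lap_refl_sub (hv : BallSol R p γ v) (hR : 0 < R) (he : ‖e‖ = 1) {l : ℝ}
    (hl : 0 < l) {x : EuclideanSpace ℝ (Fin N)} (hx : x ∈ ball 0 R)
    (hlx : l < inner ℝ e x) :
    lap (fun y => v (planeRefl e l y) - v y) x =
      max (v x) 0 ^ p - max (v (planeRefl e l x)) 0 ^ p := by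
  have hxc := ball_subset_closedBall hx
  have hm := planeRefl_mem_ball he hR.le hl hxc hlx
  rw [lap_sub (hv.contDiffAt_refl hR he hl hxc hlx) (hv.smooth x hx),
    lap_comp_planeRefl he (hv.smooth _ hm), ← hv.pde x hx, ← hv.pde _ hm]
  ring

lemma BallSol.continuousOn_refl (hv : BallSol R p γ v) (hR : 0 < R) (he : ‖e‖ = 1) {l : ℝ}
    (hl : 0 ≤ l) :
    ContinuousOn (fun y => v (planeRefl e l y) - v y)
      (closedBall 0 R ∩ {x | l ≤ inner ℝ e x}) := by
  refine ContinuousOn.sub ?_ (hv.cont.mono inter_subset_left)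
  exact hv.cont.comp (contDiff_planeRefl e l).continuous.continuousOn
    fun x hx => planeRefl_mem_closedBall he hR.le hl hx.1 hx.2

lemma BallSol.cap_lt (hv : BallSol R p γ v) (hR : 0 < R) (hN : 0 < N) (hp : 1 < p)
    (he : ‖e‖ = 1) {l : ℝ} (hl : 0 < l) (hcap : CapLe R v e l)
    {x : EuclideanSpace ℝ (Fin N)} (hx : x ∈ closedBall 0 R) (hlx : l < inner ℝ e x) :
    v x < v (planeRefl e l x) := by
  have hlR : l < R := hlx.trans_le (inner_le_of_mem_closedBall he hx)
  have hsph : ∀ y ∈ sphere (0 : EuclideanSpace ℝ (Fin N)) R, l < inner ℝ e y →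
      v y < v (planeRefl e l y) := fun y hy hly => by
    rw [hv.bdry y hy]
    exact hv.lt _ (planeRefl_mem_ball he hR.le hl (sphere_subset_closedBall hy) hly)
  by_cases hxb : x ∈ ball 0 R
  swap
  · refine hsph x ?_ hlx
    rw [mem_sphere]
    rw [mem_closedBall] at hx
    rw [mem_ball, not_lt] at hxb
    exact le_antisymm hx hxb
  have hinn : ∀ t : ℝ, inner ℝ e (t • e) = t := fun t => by
    rw [inner_smul_right, real_inner_self_eq_norm_sq, he]; ring
  have hUo : IsOpen (ball (0 : EuclideanSpace ℝ (Fin N)) R ∩ {x | l < inner ℝ e x}) :=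
    isOpen_ball.inter (isOpen_lt continuous_const (continuous_inner_left e))
  have hconv : Convex ℝ (ball (0 : EuclideanSpace ℝ (Fin N)) R ∩ {x | l < inner ℝ e x}) :=
    (convex_ball _ _).inter (convex_halfSpace_gt (innerSL ℝ e).isLinear l)
  have key := pos_of_superharmonic hN (z := fun y => v (planeRefl e l y) - v y) hUo
    hconv.isPreconnected
    (fun y hy => (hv.contDiffAt_refl hR he hl (ball_subset_closedBall hy.1) hy.2).sub
      (hv.smooth y hy.1))
    (fun y hy => sub_nonneg.2 (hcap y (ball_subset_closedBall hy.1) hy.2.le))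
    (fun y hy => by
      rw [hv.lap_refl_sub hR he hl hy.1 hy.2]
      have := posPart_rpow_mono hp (hcap y (ball_subset_closedBall hy.1) hy.2.le)
      linarith) ?_ x ⟨hxb, hlx⟩
  · simpa using key
  · have hnorm : ∀ t : ℝ, 0 ≤ t → ‖t • e‖ = t := fun t ht => by
      rw [norm_smul, he, Real.norm_eq_abs, abs_of_nonneg ht, mul_one]
    have hc : ContinuousOn (fun t : ℝ => v (planeRefl e l (t • e)) - v (t • e)) (Icc l R) := by
      refine (hv.continuousOn_refl hR he hl.le).comp (f := fun t : ℝ => t • e)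
        (by fun_prop) fun t ht => ⟨?_, ?_⟩
      · rw [mem_closedBall_zero_iff, hnorm t (hl.le.trans ht.1)]; exact ht.2
      · simp only [mem_ofPred_eq, hinn]; exact ht.1
    have hpos : 0 < v (planeRefl e l (R • e)) - v (R • e) := by
      refine sub_pos.2 (hsph _ ?_ ?_)
      · rw [mem_sphere_zero_iff_norm, hnorm R hR.le]
      · rw [hinn]; exact hlR
    have hev := (hc R ⟨hlR.le, le_rfl⟩).eventually (lt_mem_nhds hpos)
    have hev2 : ∀ᶠ t in nhdsWithin R (Ioo l R), 0 < v (planeRefl e l (t • e)) - v (t • e) :=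
      hev.filter_mono (nhdsWithin_mono _ Ioo_subset_Icc_self)
    have : (nhdsWithin R (Ioo l R)).NeBot := by
      rw [nhdsWithin_Ioo_eq_nhdsLT hlR]; infer_instance
    obtain ⟨t, ht, ht2⟩ := (hev2.and self_mem_nhdsWithin).exists
    refine ⟨t • e, ⟨?_, ?_⟩, ht⟩
    · rw [mem_ball_zero_iff, hnorm t (hl.le.trans ht2.1.le)]; exact ht2.2
    · simp only [mem_ofPred_eq, hinn]; exact ht2.1

lemma BallSol.capLe_step (hv : BallSol R p γ v) (hR : 0 < R) (hN : 0 < N) (hp : 1 < p)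
    (he : ‖e‖ = 1) {l : ℝ} (hl : 0 < l) (hcap : CapLe R v e l) :
    ∃ δ > 0, ∀ m, 0 < m → l - δ < m → m ≤ l → CapLe R v e m := by
  obtain ⟨M, hM⟩ := (isCompact_closedBall (0 : EuclideanSpace ℝ (Fin N)) R).bddAbove_image hv.cont
  have hM' : ∀ x ∈ closedBall (0 : EuclideanSpace ℝ (Fin N)) R, v x ≤ M := fun x hx =>
    hM (mem_image_of_mem v hx)
  set L : ℝ := p * max M 0 ^ (p - 1) with hL
  have hL0 : 0 ≤ L := by
    have := Real.rpow_nonneg (le_max_right M 0) (p - 1)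
    have : 0 < p := by linarith
    positivity
  set d : ℝ := 1 / (4 * (L + 1)) with hd
  have hdpos : 0 < d := by positivity
  have hdL : (L + 1) * (2 * d) ^ 2 ≤ 1 / 4 := by
    have : (L + 1) * (2 * d) ^ 2 = 1 / (4 * (L + 1)) := by rw [hd]; field_simp; norm_num
    rw [this]
    gcongr
    linarith
  have hK1 : IsCompact (closedBall (0 : EuclideanSpace ℝ (Fin N)) R ∩
      {x | l + d ≤ inner ℝ e x}) :=
    (isCompact_closedBall _ _).inter_right
      (isClosed_le continuous_const (continuous_inner_left e))
  obtain ⟨c, hc, hcz⟩ : ∃ c > 0, ∀ x ∈ closedBall (0 : EuclideanSpace ℝ (Fin N)) R ∩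
      {x | l + d ≤ inner ℝ e x}, c ≤ v (planeRefl e l x) - v x := by
    rcases (closedBall (0 : EuclideanSpace ℝ (Fin N)) R ∩
      {x | l + d ≤ inner ℝ e x}).eq_empty_or_nonempty with h | h
    · exact ⟨1, one_pos, by simp [h]⟩
    · obtain ⟨w, hw, hmin⟩ := hK1.exists_isMinOn h ((hv.continuousOn_refl hR he hl.le).mono
        (inter_subset_inter_right _ fun x hx => by
          simp only [mem_ofPred_eq] at hx ⊢; linarith))
      refine ⟨_, ?_, fun x hx => hmin hx⟩
      refine sub_pos.2 (hv.cap_lt hR hN hp he hl hcap hw.1 ?_)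
      have := hw.2
      simp only [mem_ofPred_eq] at this
      linarith
  obtain ⟨η, hη, hηv⟩ := Metric.uniformContinuousOn_iff.1
    ((isCompact_closedBall (0 : EuclideanSpace ℝ (Fin N)) R).uniformContinuousOn_of_continuous
      hv.cont) c hc
  refine ⟨min d (η / 4), by positivity, fun m hm hlm hml => ?_⟩
  have hmd : l - m < d := by have := min_le_left d (η / 4); linarith
  have hmη : l - m < η / 4 := by have := min_le_right d (η / 4); linarith
  have hfar : ∀ x ∈ closedBall (0 : EuclideanSpace ℝ (Fin N)) R, l + d ≤ inner ℝ e x →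
      v x ≤ v (planeRefl e m x) := by
    intro x hx hxl
    have h1 := hcz x ⟨hx, hxl⟩
    have h2 := hηv _ (planeRefl_mem_closedBall he hR.le hl.le hx (by linarith))
      _ (planeRefl_mem_closedBall he hR.le hm.le hx (by linarith)) (by
        rw [dist_planeRefl he, abs_of_nonneg (by linarith)]; linarith)
    rw [Real.dist_eq] at h2
    have := (abs_lt.1 h2).2
    linarith
  intro x hx hmx
  rcases le_or_gt (l + d) (inner ℝ e x) with h | hxd
  · exact hfar x hx h
  have hq : ContDiff ℝ 2 fun y : EuclideanSpace ℝ (Fin N) => (inner ℝ e y - m) ^ 2 :=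
    ((contDiff_const.inner ℝ contDiff_id).sub contDiff_const).pow 2
  have hbar : ∀ y : EuclideanSpace ℝ (Fin N), m ≤ inner ℝ e y → inner ℝ e y ≤ l + d →
      0 < 1 - (L + 1) * (inner ℝ e y - m) ^ 2 := by
    intro y h1 h2
    have h3 : (inner ℝ e y - m) ^ 2 ≤ (2 * d) ^ 2 := by
      have h4 : 0 ≤ inner ℝ e y - m := by linarith
      have h5 : inner ℝ e y - m ≤ 2 * d := by linarith
      gcongr
    have h6 : (L + 1) * (inner ℝ e y - m) ^ 2 ≤ (L + 1) * (2 * d) ^ 2 := by gcongr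
    linarith
  have key := nonneg_of_barrier (L := L)
    (K := closedBall (0 : EuclideanSpace ℝ (Fin N)) R ∩
      ({y | m ≤ inner ℝ e y} ∩ {y | inner ℝ e y ≤ l + d}))
    (U := ball (0 : EuclideanSpace ℝ (Fin N)) R ∩
      ({y | m < inner ℝ e y} ∩ {y | inner ℝ e y < l + d}))
    (z := fun y => v (planeRefl e m y) - v y)
    (h := fun y => 1 - (L + 1) * (inner ℝ e y - m) ^ 2)
    ((isCompact_closedBall _ _).inter_right
      ((isClosed_le continuous_const (continuous_inner_left e)).inter
        (isClosed_le (continuous_inner_left e) continuous_const)))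
    (isOpen_ball.inter ((isOpen_lt continuous_const (continuous_inner_left e)).inter
        (isOpen_lt (continuous_inner_left e) continuous_const)))
    (inter_subset_inter ball_subset_closedBall
      (inter_subset_inter (fun y (hy : m < inner ℝ e y) => hy.le)
        fun y (hy : inner ℝ e y < l + d) => hy.le))
    ((hv.continuousOn_refl hR he hm.le).mono
      (inter_subset_inter_right _ inter_subset_left))
    (continuous_const.sub (continuous_const.mul hq.continuous)).continuousOn
    (fun y hy => hbar y hy.2.1 hy.2.2)
    (fun y hy => (hv.contDiffAt_refl hR he hm (ball_subset_closedBall hy.1) hy.2.1).sub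
      (hv.smooth y hy.1))
    (fun y _ => contDiffAt_const.sub (contDiffAt_const.mul hq.contDiffAt))
    ?_ ?_ ?_ x ⟨hx, hmx, hxd.le⟩
  · simpa using key
  · rintro y ⟨hy, hy1, hy2⟩ hyU
    simp only [mem_ofPred_eq] at hy1 hy2
    rcases hy1.eq_or_lt with h1 | h1
    · rw [planeRefl_of_inner_eq h1.symm, sub_self]
    rcases hy2.eq_or_lt with h2 | h2
    · exact sub_nonneg.2 (hfar y hy h2.ge)
    have hyb : y ∉ ball 0 R := fun h => hyU ⟨h, h1, h2⟩
    have hys : y ∈ sphere 0 R := by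
      rw [mem_sphere]
      rw [mem_closedBall] at hy
      rw [mem_ball, not_lt] at hyb
      exact le_antisymm hy hyb
    rw [hv.bdry y hys]
    exact sub_nonneg.2 (hv.lt _ (planeRefl_mem_ball he hR.le hm hy h1)).le
  · rintro y ⟨hy, hy1, hy2⟩ hneg
    rw [hv.lap_refl_sub hR he hm hy hy1]
    have := posPart_rpow_sub_le hp (M := M) (a := v (planeRefl e m y)) (b := v y)
      (by linarith) (hM' y (ball_subset_closedBall hy))
    rw [← hL] at this
    linarith
  · rintro y ⟨hy, hy1, hy2⟩
    rw [lap_sub contDiffAt_const (contDiffAt_const.mul hq.contDiffAt), lap_const,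
      lap_const_mul _ hq.contDiffAt, lap_inner_sub_sq, he]
    have h1 := sq_nonneg (inner ℝ e y - m)
    have : 0 ≤ L * ((L + 1) * (inner ℝ e y - m) ^ 2) := by positivity
    linarith

lemma BallSol.capLe (hv : BallSol R p γ v) (hR : 0 < R) (hN : 0 < N) (hp : 1 < p)
    (he : ‖e‖ = 1) {l : ℝ} (hl : 0 < l) (hlR : l ≤ R) : CapLe R v e l := by
  have hsub : Icc 0 (R - l) ⊆ {t | CapLe R v e (R - t)} := by
    refine IsClosed.Icc_subset_of_forall_exists_gt ?_ ?_ ?_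
    · refine IsSeqClosed.isClosed fun u t hu hut => ?_
      have htI : t ∈ Icc 0 (R - l) :=
        isClosed_Icc.mem_of_tendsto hut (Eventually.of_forall fun n => (hu n).2)
      refine ⟨fun x hx hxt => ?_, htI⟩
      rcases hxt.eq_or_lt with h | h
      · rw [planeRefl_of_inner_eq h.symm]
      have hlim : Tendsto (fun n => planeRefl e (R - u n) x) atTop
          (nhdsWithin (planeRefl e (R - t) x) (closedBall 0 R)) := by
        refine tendsto_nhdsWithin_iff.2 ⟨?_, ?_⟩
        · have : Continuous fun s : ℝ => planeRefl e (R - s) x := by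
            unfold planeRefl; fun_prop
          exact (this.tendsto t).comp hut
        · have : ∀ᶠ n in atTop, R - inner ℝ e x < u n :=
            hut.eventually (lt_mem_nhds (by linarith))
          filter_upwards [this] with n hn
          exact planeRefl_mem_closedBall he hR.le (by linarith [(hu n).2.2]) hx (by linarith)
      have hvlim := (hv.cont _ (planeRefl_mem_closedBall he hR.le (by linarith [htI.2])
        hx hxt)).tendsto.comp hlim
      refine ge_of_tendsto hvlim ?_
      have : ∀ᶠ n in atTop, R - inner ℝ e x < u n :=
        hut.eventually (lt_mem_nhds (by linarith))
      filter_upwards [this] with n hn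
      exact (hu n).1 x hx (by linarith)
    · intro x hx hxt
      rw [sub_zero] at hxt
      rw [sub_zero, planeRefl_of_inner_eq (le_antisymm (inner_le_of_mem_closedBall he hx) hxt)]
    · rintro t ⟨ht, ht0, htl⟩ y hy
      have hy' : t < y := hy
      obtain ⟨δ, hδ, hstep⟩ := hv.capLe_step hR hN hp he (l := R - t) (by linarith) ht
      set s := min (min (y - t) (δ / 2)) (R - l - t) with hs
      have hspos : 0 < s := by
        refine lt_min (lt_min ?_ ?_) ?_ <;> linarith
      have h1 : s ≤ y - t := (min_le_left _ _).trans (min_le_left _ _)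
      have h2 : s ≤ δ / 2 := (min_le_left _ _).trans (min_le_right _ _)
      have h3 : s ≤ R - l - t := min_le_right _ _
      exact ⟨t + s, hstep _ (by linarith) (by linarith) (by linarith), by linarith, by linarith⟩
  have := hsub (show R - l ∈ Icc 0 (R - l) from ⟨by linarith, le_rfl⟩)
  simpa using this

lemma BallSol.le_of_norm_lt (hv : BallSol R p γ v) (hR : 0 < R) (hN : 0 < N) (hp : 1 < p)
    {x y : EuclideanSpace ℝ (Fin N)} (hy : y ∈ closedBall 0 R) (hxy : ‖x‖ < ‖y‖) :
    v y ≤ v x := by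
  set D := ‖y - x‖ with hD
  have hDpos : 0 < D := norm_pos_iff.2 (sub_ne_zero.2 fun h => by simp [h] at hxy)
  have hD2 : D ^ 2 = ‖y‖ ^ 2 - 2 * inner ℝ x y + ‖x‖ ^ 2 := by
    rw [hD, norm_sub_sq_real, real_inner_comm]
  set e := D⁻¹ • (y - x) with he
  have hen : ‖e‖ = 1 := by
    rw [he, norm_smul, ← hD, Real.norm_eq_abs, abs_of_pos (by positivity)]
    field_simp
  set l := (‖y‖ ^ 2 - ‖x‖ ^ 2) / (2 * D) with hl
  have hlpos : 0 < l := by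
    have : ‖x‖ ^ 2 < ‖y‖ ^ 2 := by gcongr
    have : 0 < ‖y‖ ^ 2 - ‖x‖ ^ 2 := by linarith
    positivity
  have hey : inner ℝ e y - l = D / 2 := by
    rw [he, inner_smul_left, inner_sub_left, real_inner_self_eq_norm_sq, hl]
    simp only [conj_trivial]
    field_simp
    rw [hD2]
    ring
  have hley : l ≤ inner ℝ e y := by linarith
  have := hv.capLe hR hN hp hen hlpos (hley.trans (inner_le_of_mem_closedBall hen hy)) y hy hley
  have hrefl : planeRefl e l y = x := by
    rw [planeRefl, hey, he, smul_smul]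
    have : 2 * (D / 2) * D⁻¹ = 1 := by field_simp
    rw [this]; module
  rwa [hrefl] at this

lemma BallSol.le_of_norm_le (hv : BallSol R p γ v) (hR : 0 < R) (hN : 0 < N) (hp : 1 < p)
    {x y : EuclideanSpace ℝ (Fin N)} (hy : y ∈ closedBall 0 R) (hxy : ‖x‖ ≤ ‖y‖) :
    v y ≤ v x := by
  by_cases hx0 : x = 0
  · rcases eq_or_ne y 0 with h | h
    · rw [hx0, h]
    · exact hv.le_of_norm_lt hR hN hp hy (by simpa [hx0] using h)
  have hxc : x ∈ closedBall (0 : EuclideanSpace ℝ (Fin N)) R := by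
    rw [mem_closedBall_zero_iff] at hy ⊢; exact hxy.trans hy
  have hlt : ∀ t ∈ Ioo (0 : ℝ) 1, ‖t • x‖ < ‖x‖ := fun t ht => by
    rw [norm_smul, Real.norm_eq_abs, abs_of_pos ht.1]
    have := norm_pos_iff.2 hx0
    nlinarith [ht.2]
  have hlim : Tendsto (fun t : ℝ => t • x) (nhdsWithin 1 (Ioo 0 1))
      (nhdsWithin x (closedBall 0 R)) := by
    refine tendsto_nhdsWithin_iff.2 ⟨?_, ?_⟩
    · have : Continuous fun t : ℝ => t • x := by fun_prop
      have h := this.tendsto 1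
      rw [one_smul] at h
      exact h.mono_left nhdsWithin_le_nhds
    · filter_upwards [self_mem_nhdsWithin] with t ht
      rw [mem_closedBall_zero_iff] at hxc ⊢
      exact (hlt t ht).le.trans hxc
  have : (nhdsWithin (1 : ℝ) (Ioo 0 1)).NeBot := by
    rw [nhdsWithin_Ioo_eq_nhdsLT one_pos]; infer_instance
  refine ge_of_tendsto ((hv.cont x hxc).tendsto.comp hlim) ?_
  filter_upwards [self_mem_nhdsWithin] with t ht
  exact hv.le_of_norm_lt hR hN hp hy ((hlt t ht).trans_le hxy)

lemma BallSol.eq_of_norm_eq (hv : BallSol R p γ v) (hR : 0 < R) (hN : 0 < N) (hp : 1 < p)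
    {x y : EuclideanSpace ℝ (Fin N)} (hy : y ∈ closedBall 0 R) (hxy : ‖x‖ = ‖y‖) :
    v x = v y :=
  le_antisymm (hv.le_of_norm_le hR hN hp (by simpa [hxy] using hy) hxy.ge)
    (hv.le_of_norm_le hR hN hp hy hxy.le)

end MovingPlane

section Radial

variable {N : ℕ} {R p γ : ℝ} {v : EuclideanSpace ℝ (Fin N) → ℝ}

lemma isPreconnected_ball_zero (R : ℝ) :
    IsPreconnected (ball (0 : EuclideanSpace ℝ (Fin N)) R) :=
  (convex_ball _ _).isPreconnected

/-- A solution of `(F)_I` with `I > 0` exceeds its boundary value inside the ball. -/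
lemma IsFBSol.ballSol {I : ℝ} (hR : 0 < R) (hN : 0 < N) (hI : 0 < I)
    (hv : IsFBSol (ball (0 : EuclideanSpace ℝ (Fin N)) R) p I γ v) : BallSol R p γ v := by
  have hcont : ContinuousOn v (closedBall 0 R) := by
    simpa [closure_ball _ hR.ne'] using hv.contOn
  have hbd : ∀ x ∈ sphere (0 : EuclideanSpace ℝ (Fin N)) R, v x = γ := by
    intro x hx
    exact hv.bdry x (by rwa [frontier_ball _ hR.ne'])
  have hsm : ∀ x ∈ ball (0 : EuclideanSpace ℝ (Fin N)) R, ContDiffAt ℝ 2 v x := fun x hx =>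
    hv.smooth.contDiffAt (isOpen_ball.mem_nhds hx)
  have hz2 : ∀ x ∈ ball (0 : EuclideanSpace ℝ (Fin N)) R,
      ContDiffAt ℝ 2 (fun y => v y - γ) x := fun x hx => (hsm x hx).sub contDiffAt_const
  have hlz : ∀ x ∈ ball (0 : EuclideanSpace ℝ (Fin N)) R, lap (fun y => v y - γ) x ≤ 0 := by
    intro x hx
    have h := lap_sub (hsm x hx) (contDiffAt_const (c := γ))
    rw [lap_const, sub_zero] at h
    have h2 := hv.pde x hx
    have h3 := posPart_rpow_nonneg p (v x)
    have h4 : lap (fun y => v y - γ) x = lap v x := h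
    linarith
  have hnn : ∀ x ∈ closedBall (0 : EuclideanSpace ℝ (Fin N)) R, 0 ≤ v x - γ :=
    nonneg_of_superharmonic hN (isCompact_closedBall 0 R) isOpen_ball
    ball_subset_closedBall (hcont.sub continuousOn_const) hz2
    (fun x hx hx' => by
      have : x ∈ sphere (0 : EuclideanSpace ℝ (Fin N)) R := by
        rw [mem_sphere_zero_iff_norm]
        rw [mem_closedBall_zero_iff] at hx
        rw [mem_ball_zero_iff] at hx'
        linarith
      simp [hbd x this]) hlz
  have hex : ∃ x ∈ ball (0 : EuclideanSpace ℝ (Fin N)) R, 0 < v x - γ := by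
    by_contra! hcon
    have heq : ∀ x ∈ ball (0 : EuclideanSpace ℝ (Fin N)) R, v x = γ := fun x hx => by
      have h1 := hcon x hx
      have h2 := hnn x (ball_subset_closedBall hx)
      linarith
    have hF : ∀ x ∈ ball (0 : EuclideanSpace ℝ (Fin N)) R, max (v x) 0 ^ p = 0 := fun x hx => by
      have h : v =ᶠ[nhds x] fun _ => γ := by
        filter_upwards [isOpen_ball.mem_nhds hx] with y hy using heq y hy
      rw [← hv.pde x hx, lap_congr h, lap_const, neg_zero]
    have := hv.constr
    rw [setIntegral_congr_fun measurableSet_ball hF] at this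
    simp at this
    linarith
  refine ⟨hcont, hsm, hv.pde, hbd, fun x hx => ?_⟩
  have := pos_of_superharmonic hN isOpen_ball (isPreconnected_ball_zero R) hz2
    (fun x hx => hnn x (ball_subset_closedBall hx)) hlz hex x hx
  linarith

/-- The restriction of a radial `C²` function to a line through the origin. -/
lemma contDiffAt_radial_profile (e : EuclideanSpace ℝ (Fin N)) (he : ‖e‖ = 1)
    (hv : ∀ x ∈ ball (0 : EuclideanSpace ℝ (Fin N)) R, ContDiffAt ℝ 2 v x) {t : ℝ}
    (ht : t ∈ Ioo (-R) R) : ContDiffAt ℝ 2 (fun s : ℝ => v (s • e)) t := by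
  have hmem : t • e ∈ ball (0 : EuclideanSpace ℝ (Fin N)) R := by
    rw [mem_ball_zero_iff, norm_smul, he, mul_one, Real.norm_eq_abs, abs_lt]
    exact ht
  exact ContDiffAt.comp t (hv _ hmem) (contDiff_id.smul contDiff_const).contDiffAt

lemma hasDerivAt_radial_profile (e : EuclideanSpace ℝ (Fin N)) (he : ‖e‖ = 1)
    (hv : ∀ x ∈ ball (0 : EuclideanSpace ℝ (Fin N)) R, ContDiffAt ℝ 2 v x) {t : ℝ}
    (ht : t ∈ Ioo (-R) R) :
    HasDerivAt (fun s : ℝ => v (s • e)) (deriv (fun s : ℝ => v (s • e)) t) t :=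
  ((contDiffAt_radial_profile e he hv ht).differentiableAt (by norm_num)).hasDerivAt

lemma hasDerivAt_deriv_radial_profile (e : EuclideanSpace ℝ (Fin N)) (he : ‖e‖ = 1)
    (hv : ∀ x ∈ ball (0 : EuclideanSpace ℝ (Fin N)) R, ContDiffAt ℝ 2 v x) {t : ℝ}
    (ht : t ∈ Ioo (-R) R) :
    HasDerivAt (deriv fun s : ℝ => v (s • e)) (deriv (deriv fun s : ℝ => v (s • e)) t) t := by
  have h := contDiffAt_radial_profile e he hv ht
  have h1 : ContDiffAt ℝ 1 (deriv fun s : ℝ => v (s • e)) t :=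
    (h.fderiv_right (m := 1) (by norm_num)).clm_apply contDiffAt_const
  exact (h1.differentiableAt (by norm_num)).hasDerivAt

lemma deriv_radial_profile_zero (e : EuclideanSpace ℝ (Fin N)) (he : ‖e‖ = 1) (hR : 0 < R)
    (hrad : ∀ x ∈ ball (0 : EuclideanSpace ℝ (Fin N)) R, ∀ y, ‖x‖ = ‖y‖ → v x = v y) :
    deriv (fun s : ℝ => v (s • e)) 0 = 0 := by
  have h : (fun s : ℝ => v (s • e)) =ᶠ[nhds 0] fun s => v ((-s) • e) := by
    filter_upwards [Ioo_mem_nhds (neg_lt_zero.2 hR) hR] with s hs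
    refine hrad _ ?_ _ (by simp [norm_smul])
    rw [mem_ball_zero_iff, norm_smul, he, mul_one, Real.norm_eq_abs, abs_lt]
    exact hs
  have h1 := h.deriv_eq
  have h2 := deriv_comp_neg (fun s : ℝ => v (s • e)) (0 : ℝ)
  rw [neg_zero] at h2
  linarith

lemma radial_profile_ode (e : EuclideanSpace ℝ (Fin N)) (he : ‖e‖ = 1)
    (hv : ∀ x ∈ ball (0 : EuclideanSpace ℝ (Fin N)) R, ContDiffAt ℝ 2 v x)
    (hrad : ∀ x ∈ ball (0 : EuclideanSpace ℝ (Fin N)) R, ∀ y, ‖x‖ = ‖y‖ → v x = v y)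
    {t : ℝ} (ht : t ∈ Ioo 0 R) :
    lap v (t • e) = deriv (deriv fun s : ℝ => v (s • e)) t +
      ((N : ℝ) - 1) / t * deriv (fun s : ℝ => v (s • e)) t := by
  have hnorm : ‖t • e‖ = t := by rw [norm_smul, he, mul_one, Real.norm_of_nonneg ht.1.le]
  have hmem : t • e ∈ ball (0 : EuclideanSpace ℝ (Fin N)) R := by
    rw [mem_ball_zero_iff, hnorm]; exact ht.2
  have h0 : t • e ≠ 0 := by
    rw [← norm_pos_iff, hnorm]; exact ht.1
  have hsub : Ioo 0 R ⊆ Ioo (-R) R := Ioo_subset_Ioo_left (by linarith [ht.1, ht.2])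
  have heq : v =ᶠ[nhds (t • e)] fun y => (fun s : ℝ => v (s • e)) ‖y‖ := by
    filter_upwards [isOpen_ball.mem_nhds hmem] with y hy
    exact hrad y hy _ (by rw [norm_smul, he, mul_one, norm_norm])
  rw [lap_congr heq]
  have := lap_comp_norm (N := N) h0 (φ := fun s : ℝ => v (s • e))
    (φ' := deriv fun s : ℝ => v (s • e)) (φ'' := deriv (deriv fun s : ℝ => v (s • e)) t)
    (by
      rw [hnorm]
      filter_upwards [Ioo_mem_nhds ht.1 ht.2] with s hs
      exact hasDerivAt_radial_profile e he hv (hsub hs))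
    (by rw [hnorm]; exact hasDerivAt_deriv_radial_profile e he hv (hsub ht))
  rw [this, hnorm]

end Radial

/-- Uniqueness for the singular initial value problem `f'' + c f'/t = -[f]₊ᵖ`, `f'(0) = 0`. -/
lemma radial_ivp_unique {p c R : ℝ} (hp : 1 < p) (hc : 0 ≤ c) {f f1 h h1 : ℝ → ℝ}
    (hf : ∀ t ∈ Ico 0 R, HasDerivAt f (f1 t) t) (hh : ∀ t ∈ Ico 0 R, HasDerivAt h (h1 t) t)
    (hf1 : ContinuousOn f1 (Ico 0 R)) (hh1 : ContinuousOn h1 (Ico 0 R))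
    (hf2 : ∀ t ∈ Ioo 0 R, HasDerivAt f1 (-(c / t * f1 t) - max (f t) 0 ^ p) t)
    (hh2 : ∀ t ∈ Ioo 0 R, HasDerivAt h1 (-(c / t * h1 t) - max (h t) 0 ^ p) t)
    (h0 : f 0 = h 0) (hf10 : f1 0 = 0) (hh10 : h1 0 = 0) : EqOn f h (Ico 0 R) := by
  intro T hT
  have hsub : Icc 0 T ⊆ Ico 0 R := fun t ht => ⟨ht.1, ht.2.trans_lt hT.2⟩
  have hfc : ContinuousOn f (Icc 0 T) := fun t ht =>
    (hf t (hsub ht)).continuousAt.continuousWithinAt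
  have hhc : ContinuousOn h (Icc 0 T) := fun t ht =>
    (hh t (hsub ht)).continuousAt.continuousWithinAt
  obtain ⟨M1, hM1⟩ := isCompact_Icc.bddAbove_image hfc
  obtain ⟨M2, hM2⟩ := isCompact_Icc.bddAbove_image hhc
  set M := max M1 M2
  have hfM : ∀ t ∈ Icc 0 T, f t ≤ M := fun t ht =>
    (hM1 (mem_image_of_mem f ht)).trans (le_max_left _ _)
  have hhM : ∀ t ∈ Icc 0 T, h t ≤ M := fun t ht =>
    (hM2 (mem_image_of_mem h ht)).trans (le_max_right _ _)
  set L := p * max M 0 ^ (p - 1)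
  have hL : 0 ≤ L := mul_nonneg (by linarith) (Real.rpow_nonneg (le_max_right _ _) _)
  have hLip : ∀ t ∈ Icc 0 T, |max (f t) 0 ^ p - max (h t) 0 ^ p| ≤ L * |f t - h t| := by
    intro t ht
    rcases le_total (f t) (h t) with hle | hle
    · have h1 := posPart_rpow_sub_le hp hle (hhM t ht)
      have h2 := posPart_rpow_mono hp hle
      rw [abs_sub_comm, abs_sub_comm (f t), abs_of_nonneg (by linarith),
        abs_of_nonneg (by linarith)]
      exact h1
    · have h1 := posPart_rpow_sub_le hp hle (hfM t ht)
      have h2 := posPart_rpow_mono hp hle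
      rw [abs_of_nonneg (by linarith), abs_of_nonneg (by linarith)]
      exact h1
  set E : ℝ → ℝ := fun t => ((f1 t - h1 t) ^ 2 + (f t - h t) ^ 2) * Real.exp (-(L + 1) * t)
    with hE
  have hEc : ContinuousOn E (Icc 0 T) := by
    refine ContinuousOn.mul ?_ (by fun_prop)
    exact (((hf1.mono hsub).sub (hh1.mono hsub)).pow 2).add ((hfc.sub hhc).pow 2)
  have hEd : ∀ t ∈ Ioo 0 T, HasDerivAt E
      ((2 * (f1 t - h1 t) * ((-(c / t * f1 t) - max (f t) 0 ^ p) -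
          (-(c / t * h1 t) - max (h t) 0 ^ p)) + 2 * (f t - h t) * (f1 t - h1 t)) *
        Real.exp (-(L + 1) * t) +
      ((f1 t - h1 t) ^ 2 + (f t - h t) ^ 2) * (Real.exp (-(L + 1) * t) * -(L + 1))) t := by
    intro t ht
    have htR : t ∈ Ioo 0 R := ⟨ht.1, ht.2.trans hT.2⟩
    have e1 := ((hf2 t htR).sub (hh2 t htR)).pow 2
    have e2 := ((hf t ⟨ht.1.le, htR.2⟩).sub (hh t ⟨ht.1.le, htR.2⟩)).pow 2
    have e3 := ((hasDerivAt_id t).const_mul (-(L + 1))).exp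
    refine HasDerivAt.congr_deriv (f := E) ((e1.add e2).mul e3) ?_
    simp
  have hanti : AntitoneOn E (Icc 0 T) := by
    refine antitoneOn_of_deriv_nonpos (convex_Icc 0 T) hEc ?_ ?_
    · intro t ht
      rw [interior_Icc] at ht
      exact (hEd t ht).differentiableAt.differentiableWithinAt
    · intro t ht
      rw [interior_Icc] at ht
      rw [(hEd t ht).deriv]
      have hl := hLip t ⟨ht.1.le, ht.2.le⟩
      have hct : 0 ≤ c / t := div_nonneg hc ht.1.le
      set a := f1 t - h1 t with ha
      set b := f t - h t with hb
      set D := max (f t) 0 ^ p - max (h t) 0 ^ p with hD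
      have key : 2 * a * (-(c / t) * a - D) + 2 * b * a ≤ (L + 1) * (a ^ 2 + b ^ 2) := by
        have k1 : -(a * D) ≤ |a| * (L * |b|) := by
          calc -(a * D) ≤ |a * D| := neg_le_abs _
            _ = |a| * |D| := abs_mul _ _
            _ ≤ _ := mul_le_mul_of_nonneg_left hl (abs_nonneg _)
        have k2 : 2 * (|a| * |b|) ≤ a ^ 2 + b ^ 2 := by
          nlinarith [sq_nonneg (|a| - |b|), sq_abs a, sq_abs b]
        have k3 : b * a ≤ |a| * |b| := by
          rw [mul_comm b a, ← abs_mul]; exact le_abs_self _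
        have k4 : 0 ≤ c / t * a ^ 2 := mul_nonneg hct (sq_nonneg _)
        have k5 := mul_le_mul_of_nonneg_left k2 hL
        nlinarith
      have hexp := (Real.exp_pos (-(L + 1) * t)).le
      have := mul_le_mul_of_nonneg_right key hexp
      have hrw : -(c / t * f1 t) - max (f t) 0 ^ p - (-(c / t * h1 t) - max (h t) 0 ^ p) =
          -(c / t) * a - D := by rw [ha, hD]; ring
      rw [hrw]
      linarith
  have hfin := hanti (left_mem_Icc.2 hT.1) (right_mem_Icc.2 hT.1) hT.1
  have hE0 : E 0 = 0 := by simp [hE, h0, hf10, hh10]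
  rw [hE0] at hfin
  have hexp := Real.exp_pos (-(L + 1) * T)
  have : (f1 T - h1 T) ^ 2 + (f T - h T) ^ 2 ≤ 0 := by
    by_contra! hcon
    exact absurd hfin (not_le.2 (mul_pos hcon hexp))
  have hsq : (f T - h T) ^ 2 ≤ 0 := by linarith [sq_nonneg (f1 T - h1 T)]
  nlinarith [pow_eq_zero_iff (two_ne_zero) |>.1 (le_antisymm hsq (sq_nonneg _))]

section Radial

variable {N : ℕ} {R p γ : ℝ} {v w : EuclideanSpace ℝ (Fin N) → ℝ}

/-- Radial `C²` solutions on a ball are determined by their value at the centre. -/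
lemma radial_solution_unique (hN : 0 < N) (hp : 1 < p)
    (hv : ∀ x ∈ ball (0 : EuclideanSpace ℝ (Fin N)) R, ContDiffAt ℝ 2 v x)
    (hw : ∀ x ∈ ball (0 : EuclideanSpace ℝ (Fin N)) R, ContDiffAt ℝ 2 w x)
    (hvr : ∀ x ∈ ball (0 : EuclideanSpace ℝ (Fin N)) R, ∀ y, ‖x‖ = ‖y‖ → v x = v y)
    (hwr : ∀ x ∈ ball (0 : EuclideanSpace ℝ (Fin N)) R, ∀ y, ‖x‖ = ‖y‖ → w x = w y)
    (hvp : ∀ x ∈ ball (0 : EuclideanSpace ℝ (Fin N)) R, -lap v x = max (v x) 0 ^ p)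
    (hwp : ∀ x ∈ ball (0 : EuclideanSpace ℝ (Fin N)) R, -lap w x = max (w x) 0 ^ p)
    (h0 : v 0 = w 0) : EqOn v w (ball 0 R) := by
  intro x hx
  have hR : 0 < R := pos_of_mem_ball hx
  set e : EuclideanSpace ℝ (Fin N) := EuclideanSpace.single ⟨0, hN⟩ 1 with hedef
  have he : ‖e‖ = 1 := by simp [hedef]
  have hsub : Ico 0 R ⊆ Ioo (-R) R := fun t ht => ⟨by linarith [ht.1], ht.2⟩
  have hmem : ∀ t ∈ Ioo 0 R, t • e ∈ ball (0 : EuclideanSpace ℝ (Fin N)) R := fun t ht => by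
    rw [mem_ball_zero_iff, norm_smul, he, mul_one, Real.norm_of_nonneg ht.1.le]; exact ht.2
  have hode : ∀ u : EuclideanSpace ℝ (Fin N) → ℝ,
      (∀ x ∈ ball (0 : EuclideanSpace ℝ (Fin N)) R, ContDiffAt ℝ 2 u x) →
      (∀ x ∈ ball (0 : EuclideanSpace ℝ (Fin N)) R, ∀ y, ‖x‖ = ‖y‖ → u x = u y) →
      (∀ x ∈ ball (0 : EuclideanSpace ℝ (Fin N)) R, -lap u x = max (u x) 0 ^ p) →
      ∀ t ∈ Ioo 0 R, HasDerivAt (deriv fun s : ℝ => u (s • e))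
        (-(((N : ℝ) - 1) / t * deriv (fun s : ℝ => u (s • e)) t) - max (u (t • e)) 0 ^ p) t := by
    intro u hu hur hup t ht
    have h1 := hasDerivAt_deriv_radial_profile e he hu (hsub ⟨ht.1.le, ht.2⟩)
    convert h1 using 1
    rw [← hup _ (hmem t ht), radial_profile_ode e he hu hur ht]
    ring
  have key := radial_ivp_unique (c := (N : ℝ) - 1) hp
    (sub_nonneg.2 (by exact_mod_cast hN))
    (fun t ht => hasDerivAt_radial_profile e he hv (hsub ht))
    (fun t ht => hasDerivAt_radial_profile e he hw (hsub ht))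
    (fun t ht => (hasDerivAt_deriv_radial_profile e he hv
      (hsub ht)).continuousAt.continuousWithinAt)
    (fun t ht => (hasDerivAt_deriv_radial_profile e he hw
      (hsub ht)).continuousAt.continuousWithinAt)
    (hode v hv hvr hvp) (hode w hw hwr hwp) (by simpa using h0)
    (deriv_radial_profile_zero e he hR hvr) (deriv_radial_profile_zero e he hR hwr)
  have hxe : ‖x‖ = ‖‖x‖ • e‖ := by rw [norm_smul, he, mul_one, norm_norm]
  rw [hvr x hx _ hxe, hwr x hx _ hxe]
  exact key ⟨norm_nonneg x, by simpa using hx⟩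

end Radial

/-- The Emden profile, continued past its zero at `1` by the radial harmonic function with the
same slope. -/
def emdenExt (N : ℕ) (g : ℝ → ℝ) (r : ℝ) : ℝ :=
  g (min |r| 1) + -deriv g 1 / ((N : ℝ) - 2) * (max r 1 ^ (2 - (N : ℝ)) - 1)

/-- The mass `∫₀ʳ s^(N-1) [G(s)]₊ᵖ ds` of the continued profile `G`. -/
def emdenMass (N : ℕ) (p : ℝ) (g : ℝ → ℝ) (r : ℝ) : ℝ :=
  ∫ s in (0 : ℝ)..r, s ^ (N - 1) * max (emdenExt N g s) 0 ^ p

/-- The derivative of the continued profile. -/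
def emdenSlope (N : ℕ) (p : ℝ) (g : ℝ → ℝ) (r : ℝ) : ℝ :=
  -emdenMass N p g r * r ^ (1 - (N : ℝ))

section Emden

variable {N : ℕ} {p : ℝ} {g : ℝ → ℝ}

lemma emdenExt_of_le_one {r : ℝ} (h0 : 0 ≤ r) (h1 : r ≤ 1) : emdenExt N g r = g r := by
  simp [emdenExt, abs_of_nonneg h0, h1]

lemma emdenExt_of_one_le (hg : IsEmdenProfile N p g) {r : ℝ} (h1 : 1 ≤ r) :
    emdenExt N g r = -deriv g 1 / ((N : ℝ) - 2) * (r ^ (2 - (N : ℝ)) - 1) := by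
  have h0 : 0 ≤ r := zero_le_one.trans h1
  simp [emdenExt, abs_of_nonneg h0, h1, hg.bdry]

lemma IsEmdenProfile.continuousOn_Icc (hg : IsEmdenProfile N p g) (hN : 0 < N) :
    ContinuousOn g (Icc 0 1) := by
  set e : EuclideanSpace ℝ (Fin N) := EuclideanSpace.single ⟨0, hN⟩ 1 with hedef
  have he : ‖e‖ = 1 := by simp [hedef]
  have h : ContinuousOn (fun t : ℝ => g ‖t • e‖) (Icc 0 1) := by
    refine hg.contOn.comp (f := fun t : ℝ => t • e) (by fun_prop) fun t ht => ?_
    rw [mem_closedBall_zero_iff, norm_smul, he, mul_one, Real.norm_of_nonneg ht.1]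
    exact ht.2
  refine h.congr fun t ht => ?_
  simp only
  rw [norm_smul, he, mul_one, Real.norm_of_nonneg ht.1]

lemma IsEmdenProfile.pos_Ico (hg : IsEmdenProfile N p g) (hN : 0 < N) {t : ℝ}
    (ht : t ∈ Ico 0 1) : 0 < g t := by
  have h : ‖(EuclideanSpace.single ⟨0, hN⟩ t : EuclideanSpace ℝ (Fin N))‖ = t := by
    simp [abs_of_nonneg ht.1]
  have := hg.pos (EuclideanSpace.single ⟨0, hN⟩ t) (by
    rw [mem_ball_zero_iff, h]; exact ht.2)
  rwa [h] at this

lemma continuous_emdenExt (hg : IsEmdenProfile N p g) (hN : 0 < N) :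
    Continuous (emdenExt N g) := by
  have h1 : Continuous fun r : ℝ => g (min |r| 1) :=
    (hg.continuousOn_Icc hN).comp_continuous (by fun_prop) fun r =>
      ⟨le_min (abs_nonneg r) zero_le_one, min_le_right _ _⟩
  have h2 : Continuous fun r : ℝ => max r 1 ^ (2 - (N : ℝ)) :=
    (continuous_id.max continuous_const).rpow_const fun r =>
      Or.inl (lt_of_lt_of_le one_pos (le_max_right r 1)).ne'
  exact h1.add (continuous_const.mul (h2.sub continuous_const))

lemma continuous_emdenMass_integrand (hg : IsEmdenProfile N p g) (hN : 0 < N) (hp : 1 < p) :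
    Continuous fun s : ℝ => s ^ (N - 1) * max (emdenExt N g s) 0 ^ p :=
  (continuous_pow _).mul ((continuous_posPart_rpow hp).comp (continuous_emdenExt hg hN))

lemma hasDerivAt_emdenMass (hg : IsEmdenProfile N p g) (hN : 0 < N) (hp : 1 < p) (r : ℝ) :
    HasDerivAt (emdenMass N p g) (r ^ (N - 1) * max (emdenExt N g r) 0 ^ p) r :=
  (continuous_emdenMass_integrand hg hN hp).integral_hasStrictDerivAt 0 r |>.hasDerivAt

lemma emdenMass_zero : emdenMass N p g 0 = 0 := by simp [emdenMass]

lemma rpow_one_sub_mul_pow (hN : 0 < N) {r : ℝ} (hr : 0 < r) :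
    r ^ (1 - (N : ℝ)) * r ^ (N - 1) = 1 := by
  rw [← Real.rpow_natCast r (N - 1), ← Real.rpow_add hr, Nat.cast_sub hN]
  simp

lemma hasDerivAt_emdenSlope (hg : IsEmdenProfile N p g) (hN : 0 < N) (hp : 1 < p) {r : ℝ}
    (hr : 0 < r) : HasDerivAt (emdenSlope N p g)
      (-max (emdenExt N g r) 0 ^ p - ((N : ℝ) - 1) / r * emdenSlope N p g r) r := by
  have h1 := (hasDerivAt_emdenMass hg hN hp r).neg
  have h2 := Real.hasDerivAt_rpow_const (p := 1 - (N : ℝ)) (Or.inl hr.ne')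
  refine HasDerivAt.congr_deriv (f := emdenSlope N p g) (h1.mul h2) ?_
  have h3 := rpow_one_sub_mul_pow hN hr
  rw [Real.rpow_sub_one hr.ne']
  simp only [Pi.neg_apply, emdenSlope]
  field_simp
  linear_combination (-r * max (emdenExt N g r) 0 ^ p) * h3

lemma emdenExt_hasDerivAt_of_lt_one (hg : IsEmdenProfile N p g) (hN : 2 ≤ N) (hp : 1 < p)
    {r : ℝ} (hr : r ∈ Ioo 0 1) : HasDerivAt (emdenExt N g) (emdenSlope N p g r) r := by
  have hN0 : 0 < N := by omega
  set e : EuclideanSpace ℝ (Fin N) := EuclideanSpace.single ⟨0, hN0⟩ 1 with hedef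
  have he : ‖e‖ = 1 := by simp [hedef]
  set v : EuclideanSpace ℝ (Fin N) → ℝ := fun x => g ‖x‖ with hv
  set φ : ℝ → ℝ := fun s => v (s • e) with hφ
  have hsm : ∀ x ∈ ball (0 : EuclideanSpace ℝ (Fin N)) 1, ContDiffAt ℝ 2 v x := fun x hx =>
    hg.smooth.contDiffAt (isOpen_ball.mem_nhds hx)
  have hrad : ∀ x ∈ ball (0 : EuclideanSpace ℝ (Fin N)) 1, ∀ y, ‖x‖ = ‖y‖ → v x = v y :=
    fun x _ y hxy => by simp only [hv, hxy]
  have hnorm : ∀ t : ℝ, 0 ≤ t → ‖t • e‖ = t := fun t ht => by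
    rw [norm_smul, he, mul_one, Real.norm_of_nonneg ht]
  have hφG : ∀ t ∈ Ico (0 : ℝ) 1, φ t = emdenExt N g t := fun t ht => by
    rw [emdenExt_of_le_one ht.1 ht.2.le]
    simp only [hφ, hv, hnorm t ht.1]
  have hmem : ∀ t ∈ Ico (0 : ℝ) 1, t • e ∈ ball (0 : EuclideanSpace ℝ (Fin N)) 1 :=
    fun t ht => by rw [mem_ball_zero_iff, hnorm t ht.1]; exact ht.2
  have hsub : ∀ t ∈ Ico (0 : ℝ) 1, t ∈ Ioo (-1 : ℝ) 1 := fun t ht =>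
    ⟨by linarith [ht.1], ht.2⟩
  have hd2 : ∀ t ∈ Ioo (0 : ℝ) 1, HasDerivAt (deriv φ)
      (-((N : ℝ) - 1) / t * deriv φ t - max (emdenExt N g t) 0 ^ p) t := fun t ht => by
    have ht' := Ioo_subset_Ico_self ht
    refine (hasDerivAt_deriv_radial_profile e he hsm (hsub t ht')).congr_deriv ?_
    have h1 := radial_profile_ode e he hsm hrad ht
    have h2 := hg.pde _ (hmem t ht')
    rw [hnorm t ht'.1] at h2
    rw [emdenExt_of_le_one ht'.1 ht'.2.le, max_eq_left (hg.pos_Ico hN0 ht').le, ← h2]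
    change _ = _ - -lap v (t • e)
    rw [h1]
    ring
  have hcont : ContinuousOn (fun t => t ^ (N - 1) * deriv φ t + emdenMass N p g t)
      (Icc 0 r) := by
    refine ContinuousOn.add (ContinuousOn.mul (by fun_prop) fun t ht => ?_) fun t _ =>
      (hasDerivAt_emdenMass hg hN0 hp t).continuousAt.continuousWithinAt
    exact (hasDerivAt_deriv_radial_profile e he hsm
      (hsub t ⟨ht.1, ht.2.trans_lt hr.2⟩)).continuousAt.continuousWithinAt
  obtain ⟨c, -, hc⟩ := exists_hasDerivAt_eq_slope
    (fun t => t ^ (N - 1) * deriv φ t + emdenMass N p g t) (fun _ => 0) hr.1 hcont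
    (fun t ht => by
      have ht1 : t ∈ Ioo (0 : ℝ) 1 := ⟨ht.1, ht.2.trans hr.2⟩
      have ht0 : t ≠ 0 := ht.1.ne'
      refine (((hasDerivAt_pow (N - 1) t).mul (hd2 t ht1)).add
        (hasDerivAt_emdenMass hg hN0 hp t)).congr_deriv ?_
      have hpow : t ^ (N - 1) = t ^ (N - 1 - 1) * t := by
        rw [← pow_succ]; congr 1; omega
      rw [hpow, Nat.cast_sub hN0]
      push_cast
      field_simp
      ring)
  have hN1 : N - 1 ≠ 0 := by omega
  have hkey : r ^ (N - 1) * deriv φ r = -emdenMass N p g r := by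
    have h := hc.symm
    rw [div_eq_zero_iff] at h
    rcases h with h | h
    · simp only [emdenMass_zero, zero_pow hN1] at h
      linarith
    · linarith [hr.1]
  have hslope : deriv φ r = emdenSlope N p g r := by
    rw [emdenSlope, ← hkey]
    linear_combination (-deriv φ r) * rpow_one_sub_mul_pow hN0 hr.1
  rw [← hslope]
  refine (hasDerivAt_radial_profile e he hsm (hsub r
    (Ioo_subset_Ico_self hr))).congr_of_eventuallyEq ?_
  filter_upwards [Ioo_mem_nhds hr.1 hr.2] with t ht
  exact (hφG t (Ioo_subset_Ico_self ht)).symm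

lemma emdenMass_one (hg : IsEmdenProfile N p g) (hN : 2 ≤ N) (hp : 1 < p) :
    HasDerivWithinAt (emdenExt N g) (emdenSlope N p g 1) (Iic 1) 1 ∧
      emdenMass N p g 1 = -deriv g 1 := by
  have hN0 : 0 < N := by omega
  have h1 : HasDerivWithinAt (emdenExt N g) (emdenSlope N p g 1) (Iic 1) 1 := by
    refine hasDerivWithinAt_Iic_of_tendsto_deriv (s := Ioo 0 1)
      (fun t ht => (emdenExt_hasDerivAt_of_lt_one hg hN hp
        ht).differentiableAt.differentiableWithinAt)
      (continuous_emdenExt hg hN0).continuousWithinAt (Ioo_mem_nhdsLT one_pos) ?_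
    have h2 := (hasDerivAt_emdenSlope hg hN0 hp one_pos).continuousAt.tendsto
    refine (h2.mono_left nhdsWithin_le_nhds).congr' ?_
    filter_upwards [Ioo_mem_nhdsLT (one_pos : (0 : ℝ) < 1)] with t ht
    exact (emdenExt_hasDerivAt_of_lt_one hg hN hp ht).deriv.symm
  refine ⟨h1, ?_⟩
  have h2 : HasDerivWithinAt (emdenExt N g) (deriv g 1) (Icc 0 1) 1 :=
    hg.diff.hasDerivAt.hasDerivWithinAt.congr (fun t ht => emdenExt_of_le_one ht.1 ht.2)
      (emdenExt_of_le_one zero_le_one le_rfl)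
  have h3 := (uniqueDiffOn_Icc_zero_one 1 (by simp)).eq_deriv _ (h1.mono Icc_subset_Iic_self) h2
  simp only [emdenSlope, Real.one_rpow, mul_one] at h3
  linarith

lemma emdenExt_nonpos (hg : IsEmdenProfile N p g) (hN : 3 ≤ N) {r : ℝ} (hr : 1 ≤ r) :
    emdenExt N g r ≤ 0 := by
  have hN' : (3 : ℝ) ≤ N := by exact_mod_cast hN
  rw [emdenExt_of_one_le hg hr]
  refine mul_nonpos_of_nonneg_of_nonpos
    (div_nonneg (by linarith [hg.dneg]) (by linarith)) ?_
  linarith [Real.rpow_le_one_of_one_le_of_nonpos hr (by linarith : 2 - (N : ℝ) ≤ 0)]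

lemma emdenMass_of_one_le (hg : IsEmdenProfile N p g) (hN : 3 ≤ N) (hp : 1 < p) {r : ℝ}
    (hr : 1 ≤ r) : emdenMass N p g r = -deriv g 1 := by
  rw [← (emdenMass_one hg (by omega) hp).2, emdenMass, emdenMass,
    ← intervalIntegral.integral_add_adjacent_intervals (b := 1)
      ((continuous_emdenMass_integrand hg (by omega) hp).intervalIntegrable _ _)
      ((continuous_emdenMass_integrand hg (by omega) hp).intervalIntegrable _ _)]
  rw [add_eq_left, intervalIntegral.integral_zero_ae]
  refine Eventually.of_forall fun s hs => ?_
  rw [uIoc_of_le hr] at hs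
  rw [max_eq_right (emdenExt_nonpos hg hN hs.1.le), Real.zero_rpow (by linarith), mul_zero]

lemma hasDerivAt_emdenExt (hg : IsEmdenProfile N p g) (hN : 3 ≤ N) (hp : 1 < p) {r : ℝ}
    (hr : 0 < r) : HasDerivAt (emdenExt N g) (emdenSlope N p g r) r := by
  rcases lt_or_ge r 1 with h1 | h1
  · exact emdenExt_hasDerivAt_of_lt_one hg (by omega) hp ⟨hr, h1⟩
  have hN' : (3 : ℝ) ≤ N := by exact_mod_cast hN
  have hd : HasDerivAt (fun s : ℝ => -deriv g 1 / ((N : ℝ) - 2) * (s ^ (2 - (N : ℝ)) - 1))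
      (emdenSlope N p g r) r := by
    refine (((Real.hasDerivAt_rpow_const (p := 2 - (N : ℝ)) (Or.inl hr.ne')).sub_const
      1).const_mul (-deriv g 1 / ((N : ℝ) - 2))).congr_deriv ?_
    rw [emdenSlope, emdenMass_of_one_le hg hN hp h1]
    have : (N : ℝ) - 2 ≠ 0 := by linarith
    rw [show 2 - (N : ℝ) - 1 = 1 - N by ring]
    field_simp
    ring
  rcases h1.eq_or_lt with h1 | h1
  · subst h1
    have hr' : HasDerivWithinAt (emdenExt N g) (emdenSlope N p g 1) (Ici 1) 1 :=
      hd.hasDerivWithinAt.congr (fun s hs => emdenExt_of_one_le hg hs)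
        (emdenExt_of_one_le hg le_rfl)
    have := (emdenMass_one hg (by omega) hp).1.union hr'
    rwa [Iic_union_Ici, hasDerivWithinAt_univ] at this
  · refine hd.congr_of_eventuallyEq ?_
    filter_upwards [Ioi_mem_nhds h1] with s hs using emdenExt_of_one_le hg (le_of_lt hs)

lemma contDiffOn_emdenExt (hg : IsEmdenProfile N p g) (hN : 3 ≤ N) (hp : 1 < p) :
    ContDiffOn ℝ 2 (emdenExt N g) (Ioi 0) := by
  have hS : ContDiffOn ℝ 1 (emdenSlope N p g) (Ioi 0) := by
    rw [show (1 : WithTop ℕ∞) = 0 + 1 by norm_num, contDiffOn_succ_iff_deriv_of_isOpen isOpen_Ioi]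
    refine ⟨fun r hr => (hasDerivAt_emdenSlope hg (by omega) hp
      hr).differentiableAt.differentiableWithinAt, by simp, ?_⟩
    rw [contDiffOn_zero]
    refine ContinuousOn.congr (f := fun r => -max (emdenExt N g r) 0 ^ p -
      ((N : ℝ) - 1) / r * emdenSlope N p g r) ?_ fun r hr =>
      (hasDerivAt_emdenSlope hg (by omega) hp hr).deriv
    refine ContinuousOn.sub ?_ (ContinuousOn.mul ?_ ?_)
    · exact ((continuous_posPart_rpow hp).comp
        (continuous_emdenExt hg (by omega))).neg.continuousOn
    · exact continuousOn_const.div continuousOn_id fun r hr => ne_of_gt hr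
    · exact fun r hr => (hasDerivAt_emdenSlope hg (by omega) hp
        hr).continuousAt.continuousWithinAt
  rw [show (2 : WithTop ℕ∞) = 1 + 1 by norm_num, contDiffOn_succ_iff_deriv_of_isOpen isOpen_Ioi]
  exact ⟨fun r hr => (hasDerivAt_emdenExt hg hN hp hr).differentiableAt.differentiableWithinAt,
    by simp, hS.congr fun r hr => (hasDerivAt_emdenExt hg hN hp hr).deriv⟩

lemma emdenExt_norm_eventuallyEq {x : EuclideanSpace ℝ (Fin N)} (hx : x ∈ ball 0 1) :
    (fun y : EuclideanSpace ℝ (Fin N) => emdenExt N g ‖y‖) =ᶠ[nhds x] fun y => g ‖y‖ := by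
  filter_upwards [isOpen_ball.mem_nhds hx] with y hy
  exact emdenExt_of_le_one (norm_nonneg y) (by simpa using (mem_ball_zero_iff.1 hy).le)

lemma contDiff_emdenExt_norm (hg : IsEmdenProfile N p g) (hN : 3 ≤ N) (hp : 1 < p) :
    ContDiff ℝ 2 fun x : EuclideanSpace ℝ (Fin N) => emdenExt N g ‖x‖ := by
  refine contDiff_iff_contDiffAt.2 fun x => ?_
  rcases eq_or_ne x 0 with rfl | hx
  · have h0 : (0 : EuclideanSpace ℝ (Fin N)) ∈ ball 0 1 := mem_ball_self one_pos
    exact (hg.smooth.contDiffAt (isOpen_ball.mem_nhds h0)).congr_of_eventuallyEq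
      (emdenExt_norm_eventuallyEq h0)
  · exact ContDiffAt.comp x ((contDiffOn_emdenExt hg hN hp).contDiffAt
      (Ioi_mem_nhds (norm_pos_iff.2 hx))) (contDiffAt_norm ℝ hx)

lemma lap_emdenExt_norm (hg : IsEmdenProfile N p g) (hN : 3 ≤ N) (hp : 1 < p)
    (x : EuclideanSpace ℝ (Fin N)) :
    -lap (fun y : EuclideanSpace ℝ (Fin N) => emdenExt N g ‖y‖) x =
      max (emdenExt N g ‖x‖) 0 ^ p := by
  rcases eq_or_ne x 0 with rfl | hx
  · have h0 : (0 : EuclideanSpace ℝ (Fin N)) ∈ ball 0 1 := mem_ball_self one_pos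
    rw [lap_congr (emdenExt_norm_eventuallyEq h0), hg.pde 0 h0,
      emdenExt_of_le_one (norm_nonneg _) (by simp), max_eq_left (hg.pos 0 h0).le]
  · have hr := norm_pos_iff.2 hx
    rw [lap_comp_norm hx (φ' := emdenSlope N p g) (by
      filter_upwards [Ioi_mem_nhds hr] with s hs using hasDerivAt_emdenExt hg hN hp hs)
      (hasDerivAt_emdenSlope hg (by omega) hp hr)]
    ring

end Emden

/-- The rescaled continuation `x ↦ μ^(2/(p-1)) G(μ|x|)` of the Emden solution. -/
def emdenScaled (N : ℕ) (p : ℝ) (g : ℝ → ℝ) (μ : ℝ) (x : EuclideanSpace ℝ (Fin N)) : ℝ :=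
  μ ^ (2 / (p - 1)) * emdenExt N g (μ * ‖x‖)

/-- The mass of `emdenScaled` on the ball of radius `R`. -/
def emdenScaledMass (N : ℕ) (p : ℝ) (g : ℝ → ℝ) (R μ : ℝ) : ℝ :=
  (N : ℝ) * omegaN N * (μ ^ (2 * p / (p - 1) - N) * emdenMass N p g (μ * R))

lemma omegaN_pos (N : ℕ) : 0 < omegaN N :=
  ENNReal.toReal_pos (measure_ball_pos _ _ one_pos).ne' measure_ball_lt_top.ne

lemma RN_pos (N : ℕ) : 0 < RN N := Real.rpow_pos_of_pos (omegaN_pos N) _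

lemma posPart_mul_rpow {c : ℝ} (hc : 0 ≤ c) (p t : ℝ) :
    max (c * t) 0 ^ p = c ^ p * max t 0 ^ p := by
  rw [← Real.mul_rpow hc (le_max_right _ _), mul_max_of_nonneg _ _ hc, mul_zero]

section Scaled

variable {N : ℕ} {p R μ : ℝ} {g : ℝ → ℝ}

lemma emdenScaled_eq (hμ : 0 < μ) : emdenScaled N p g μ =
    fun x => μ ^ (2 / (p - 1)) *
      (fun y : EuclideanSpace ℝ (Fin N) => emdenExt N g ‖y‖) (μ • x) := by
  funext x
  simp only [emdenScaled, norm_smul, Real.norm_of_nonneg hμ.le]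

lemma rpow_scaling_exponent (hp : 1 < p) (hμ : 0 < μ) :
    (μ ^ (2 / (p - 1))) ^ p = μ ^ (2 / (p - 1)) * μ ^ 2 := by
  have : p - 1 ≠ 0 := by linarith
  rw [← Real.rpow_mul hμ.le, ← Real.rpow_natCast μ 2, ← Real.rpow_add hμ]
  congr 1
  push_cast
  field_simp
  ring

lemma contDiff_emdenScaled (hg : IsEmdenProfile N p g) (hN : 3 ≤ N) (hp : 1 < p) (hμ : 0 < μ) :
    ContDiff ℝ 2 (emdenScaled N p g μ) := by
  rw [emdenScaled_eq hμ]
  exact contDiff_const.mul ((contDiff_emdenExt_norm hg hN hp).comp (contDiff_const_smul μ))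

lemma lap_emdenScaled (hg : IsEmdenProfile N p g) (hN : 3 ≤ N) (hp : 1 < p) (hμ : 0 < μ)
    (x : EuclideanSpace ℝ (Fin N)) :
    -lap (emdenScaled N p g μ) x = max (emdenScaled N p g μ x) 0 ^ p := by
  have hV := contDiff_emdenExt_norm hg hN hp
  have h1 := lap_const_mul (μ ^ (2 / (p - 1)))
    (hV.comp (contDiff_const_smul μ)).contDiffAt (x := x)
  have h2 := lap_comp_smul (x := x) μ hV
  have h3 := lap_emdenExt_norm hg hN hp (μ • x)
  have h1' : lap (emdenScaled N p g μ) x = μ ^ (2 / (p - 1)) *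
      lap (fun y => (fun y : EuclideanSpace ℝ (Fin N) => emdenExt N g ‖y‖) (μ • y)) x := by
    rw [emdenScaled_eq hμ]; exact h1
  rw [h1', h2, emdenScaled, posPart_mul_rpow (Real.rpow_nonneg hμ.le _),
    rpow_scaling_exponent hp hμ]
  rw [norm_smul, Real.norm_of_nonneg hμ.le] at h3
  rw [← h3]
  ring

lemma integral_emdenScaled (hN : 0 < N) (hR : 0 < R) (hμ : 0 < μ) :
    ∫ x in ball (0 : EuclideanSpace ℝ (Fin N)) R, max (emdenScaled N p g μ x) 0 ^ p =
      emdenScaledMass N p g R μ := by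
  set f : ℝ → ℝ := fun r => max (μ ^ (2 / (p - 1)) * emdenExt N g (μ * r)) 0 ^ p with hf
  have h1 : ∫ x in ball (0 : EuclideanSpace ℝ (Fin N)) R, max (emdenScaled N p g μ x) 0 ^ p =
      ∫ x : EuclideanSpace ℝ (Fin N), (Iio R).indicator f ‖x‖ := by
    rw [← integral_indicator measurableSet_ball]
    congr 1
    funext x
    simp only [indicator, mem_ball_zero_iff, mem_Iio]
    rfl
  have : Nonempty (Fin N) := ⟨⟨0, hN⟩⟩
  have : Nontrivial (EuclideanSpace ℝ (Fin N)) :=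
    ⟨EuclideanSpace.single ⟨0, hN⟩ 1, 0, by simp⟩
  rw [h1, integral_fun_norm_addHaar]
  have h2 : ∫ y in Ioi (0 : ℝ), y ^ (Module.finrank ℝ (EuclideanSpace ℝ (Fin N)) - 1) •
      (Iio R).indicator f y = ∫ y in (0 : ℝ)..R, y ^ (N - 1) * f y := by
    rw [finrank_euclideanSpace_fin, intervalIntegral.integral_of_le hR.le,
      integral_Ioc_eq_integral_Ioo, ← Ioi_inter_Iio, inter_comm,
      ← Measure.restrict_restrict measurableSet_Iio, ← integral_indicator measurableSet_Iio]
    congr 1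
    funext y
    by_cases hy : y ∈ Iio R <;> simp [hy]
  have h3 : ∫ y in (0 : ℝ)..R, y ^ (N - 1) * f y =
      μ ^ (2 * p / (p - 1) - N) * emdenMass N p g (μ * R) := by
    have h4 : ∀ y : ℝ, y ^ (N - 1) * f y = μ ^ (2 * p / (p - 1) - N + 1) *
        ((fun s => s ^ (N - 1) * max (emdenExt N g s) 0 ^ p) (μ * y)) := fun y => by
      simp only [hf]
      rw [posPart_mul_rpow (Real.rpow_nonneg hμ.le _), ← Real.rpow_mul hμ.le, mul_pow,
        show 2 / (p - 1) * p = (2 * p / (p - 1) - N + 1) + ((N - 1 : ℕ) : ℝ) by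
          rw [Nat.cast_sub hN]; push_cast; ring,
        Real.rpow_add hμ, Real.rpow_natCast]
      ring
    have h5 := intervalIntegral.integral_comp_mul_left (a := 0) (b := R)
      (fun s => s ^ (N - 1) * max (emdenExt N g s) 0 ^ p) hμ.ne'
    simp_rw [h4]
    rw [intervalIntegral.integral_const_mul, h5,
      mul_zero, smul_eq_mul, Real.rpow_add_one hμ.ne', emdenMass]
    field_simp
  rw [h2, h3, emdenScaledMass, finrank_euclideanSpace_fin, nsmul_eq_mul, smul_eq_mul, mul_assoc]
  rfl

lemma isFBSol_emdenScaled (hg : IsEmdenProfile N p g) (hN : 3 ≤ N) (hp : 1 < p) (hR : 0 < R)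
    (hμ : 0 < μ) : IsFBSol (ball (0 : EuclideanSpace ℝ (Fin N)) R) p
      (emdenScaledMass N p g R μ) (μ ^ (2 / (p - 1)) * emdenExt N g (μ * R))
      (emdenScaled N p g μ) where
  contOn := (contDiff_emdenScaled hg hN hp hμ).continuous.continuousOn
  smooth := (contDiff_emdenScaled hg hN hp hμ).contDiffOn
  pde x _ := lap_emdenScaled hg hN hp hμ x
  bdry x hx := by
    rw [frontier_ball _ hR.ne', mem_sphere_zero_iff_norm] at hx
    rw [emdenScaled, hx]
  constr := integral_emdenScaled (by omega) hR hμ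

lemma emdenMass_mono (hg : IsEmdenProfile N p g) (hN : 0 < N) (hp : 1 < p) :
    MonotoneOn (emdenMass N p g) (Ici 0) := by
  refine monotoneOn_of_deriv_nonneg (convex_Ici 0)
    (fun r _ => (hasDerivAt_emdenMass hg hN hp r).continuousAt.continuousWithinAt)
    (fun r _ => (hasDerivAt_emdenMass hg hN hp r).differentiableAt.differentiableWithinAt)
    fun r hr => ?_
  rw [interior_Ici, mem_Ioi] at hr
  rw [(hasDerivAt_emdenMass hg hN hp r).deriv]
  exact mul_nonneg (pow_nonneg hr.le _) (posPart_rpow_nonneg _ _)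

lemma emdenMass_pos (hg : IsEmdenProfile N p g) (hN : 0 < N) (hp : 1 < p) {r : ℝ}
    (hr : 0 < r) : 0 < emdenMass N p g r := by
  have hr' : 0 < min r 1 := lt_min hr one_pos
  refine lt_of_lt_of_le ?_ (emdenMass_mono hg hN hp (mem_Ici.2 hr'.le) (mem_Ici.2 hr.le)
    (min_le_left r 1))
  refine intervalIntegral.intervalIntegral_pos_of_pos_on
    ((continuous_emdenMass_integrand hg hN hp).intervalIntegrable _ _) (fun s hs => ?_) hr'
  have hs1 : s < 1 := hs.2.trans_le (min_le_right _ _)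
  refine mul_pos (pow_pos hs.1 _) (Real.rpow_pos_of_pos (lt_max_of_lt_left ?_) _)
  rw [emdenExt_of_le_one hs.1.le hs1.le]
  exact hg.pos_Ico hN ⟨hs.1.le, hs1⟩

lemma scaling_exponent_pos (hN : 3 ≤ N) (hp : 1 < p) (hpN : p < (N : ℝ) / ((N : ℝ) - 2)) :
    0 < 2 * p / (p - 1) - N := by
  have hN' : (3 : ℝ) ≤ N := by exact_mod_cast hN
  rw [lt_div_iff₀ (by linarith)] at hpN
  rw [sub_pos, lt_div_iff₀ (by linarith)]
  nlinarith

lemma emdenScaledMass_strictMonoOn (hg : IsEmdenProfile N p g) (hN : 3 ≤ N) (hp : 1 < p)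
    (hpN : p < (N : ℝ) / ((N : ℝ) - 2)) (hR : 0 < R) :
    StrictMonoOn (emdenScaledMass N p g R) (Ioi 0) := by
  intro a ha b hb hab
  rw [mem_Ioi] at ha hb
  have hNpos : (0 : ℝ) < N := by exact_mod_cast (by omega : 0 < N)
  refine mul_lt_mul_of_pos_left ?_ (mul_pos hNpos (omegaN_pos N))
  have hm := emdenMass_mono hg (by omega) hp (mem_Ici.2 (mul_pos ha hR).le)
    (mem_Ici.2 (mul_pos hb hR).le) (mul_le_mul_of_nonneg_right hab.le hR.le)
  exact mul_lt_mul (Real.rpow_lt_rpow ha.le hab (scaling_exponent_pos hN hp hpN)) hm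
    (emdenMass_pos hg (by omega) hp (mul_pos ha hR)) (Real.rpow_nonneg hb.le _)

lemma emdenScaledMass_surj (hg : IsEmdenProfile N p g) (hN : 3 ≤ N) (hp : 1 < p)
    (hpN : p < (N : ℝ) / ((N : ℝ) - 2)) (hR : 0 < R) {I : ℝ} (hI : 0 < I) :
    ∃ μ, 0 < μ ∧ emdenScaledMass N p g R μ = I := by
  have hκ := scaling_exponent_pos hN hp hpN
  have hNpos : (0 : ℝ) < N := by exact_mod_cast (by omega : 0 < N)
  have hC : 0 < (N : ℝ) * omegaN N * -deriv g 1 :=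
    mul_pos (mul_pos hNpos (omegaN_pos N)) (by linarith [hg.dneg])
  have hcont : Continuous (emdenScaledMass N p g R) := by
    refine continuous_const.mul (((continuous_id.rpow_const fun _ => Or.inr hκ.le)).mul ?_)
    exact (continuous_iff_continuousAt.2 fun r =>
      (hasDerivAt_emdenMass hg (by omega) hp r).continuousAt).comp (continuous_mul_const R)
  obtain ⟨b, hb1, hb2⟩ := ((eventually_ge_atTop (1 / R)).and
    ((tendsto_rpow_atTop hκ).eventually_ge_atTop (I / (N * omegaN N * -deriv g 1)))).exists
  have hb0 : 0 ≤ b := (one_div_pos.2 hR).le.trans hb1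
  have hbI : I ≤ emdenScaledMass N p g R b := by
    rw [div_le_iff₀ hC] at hb2
    rw [emdenScaledMass, emdenMass_of_one_le hg hN hp (by rwa [div_le_iff₀ hR] at hb1)]
    linarith
  have h0 : emdenScaledMass N p g R 0 = 0 := by simp [emdenScaledMass, emdenMass_zero]
  obtain ⟨μ, hμ, hμI⟩ := intermediate_value_Icc hb0 hcont.continuousOn
    (show I ∈ Icc _ _ from ⟨by rw [h0]; exact hI.le, hbI⟩)
  refine ⟨μ, lt_of_le_of_ne hμ.1 fun h => ?_, hμI⟩
  rw [← h, h0] at hμI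
  linarith

/-- Every solution of `(F)_I` on a ball is a rescaled continued Emden solution. -/
lemma IsFBSol.exists_emdenScaled (hg : IsEmdenProfile N p g) (hN : 3 ≤ N) (hp : 1 < p)
    (hR : 0 < R) {I γ : ℝ} (hI : 0 < I) {v : EuclideanSpace ℝ (Fin N) → ℝ}
    (hv : IsFBSol (ball (0 : EuclideanSpace ℝ (Fin N)) R) p I γ v) :
    ∃ μ, 0 < μ ∧ EqOn v (emdenScaled N p g μ) (closedBall 0 R) ∧
      γ = μ ^ (2 / (p - 1)) * emdenExt N g (μ * R) ∧ I = emdenScaledMass N p g R μ := by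
  have hN0 : 0 < N := by omega
  have hb := hv.ballSol hR hN0 hI
  have hv0 : 0 < v 0 := by
    by_contra! hcon
    have hF : ∀ x ∈ ball (0 : EuclideanSpace ℝ (Fin N)) R, max (v x) 0 ^ p = 0 := fun x hx => by
      have := hb.le_of_norm_le (x := 0) hR hN0 hp (ball_subset_closedBall hx) (by simp)
      rw [max_eq_right (this.trans hcon), Real.zero_rpow (by linarith)]
    have := hv.constr
    rw [setIntegral_congr_fun measurableSet_ball hF, integral_zero] at this
    linarith
  have hg0 : 0 < g 0 := hg.pos_Ico hN0 ⟨le_rfl, one_pos⟩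
  have hq : 0 < v 0 / g 0 := div_pos hv0 hg0
  have hp1 : p - 1 ≠ 0 := by linarith
  set μ := (v 0 / g 0) ^ ((p - 1) / 2) with hμdef
  have hμ : 0 < μ := Real.rpow_pos_of_pos hq _
  have hμa : μ ^ (2 / (p - 1)) = v 0 / g 0 := by
    rw [hμdef, ← Real.rpow_mul hq.le, show (p - 1) / 2 * (2 / (p - 1)) = 1 by field_simp,
      Real.rpow_one]
  have hball : EqOn v (emdenScaled N p g μ) (ball 0 R) := by
    refine radial_solution_unique hN0 hp hb.smooth
      (fun x _ => (contDiff_emdenScaled hg hN hp hμ).contDiffAt)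
      (fun x hx y hxy => (hb.eq_of_norm_eq hR hN0 hp (ball_subset_closedBall hx) hxy.symm).symm)
      (fun x _ y hxy => by simp only [emdenScaled, hxy]) hb.pde
      (fun x _ => lap_emdenScaled hg hN hp hμ x) ?_
    rw [emdenScaled, norm_zero, mul_zero, emdenExt_of_le_one le_rfl zero_le_one, hμa]
    field_simp
  have hcl : EqOn v (emdenScaled N p g μ) (closedBall 0 R) :=
    hball.of_subset_closure hb.cont
      (contDiff_emdenScaled hg hN hp hμ).continuous.continuousOn ball_subset_closedBall
      (closure_ball _ hR.ne').ge
  refine ⟨μ, hμ, hcl, ?_, ?_⟩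
  · have hs : (EuclideanSpace.single ⟨0, hN0⟩ R : EuclideanSpace ℝ (Fin N)) ∈ sphere 0 R := by
      simp [abs_of_pos hR]
    rw [← hb.bdry _ hs, hcl (sphere_subset_closedBall hs), emdenScaled,
      mem_sphere_zero_iff_norm.1 hs]
  · rw [← hv.constr, ← integral_emdenScaled hN0 hR hμ]
    exact setIntegral_congr_fun measurableSet_ball fun x hx => by simp only [hball hx]

lemma emdenExt_neg (hg : IsEmdenProfile N p g) (hN : 3 ≤ N) {r : ℝ} (hr : 1 < r) :
    emdenExt N g r < 0 := by
  have hN' : (3 : ℝ) ≤ N := by exact_mod_cast hN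
  rw [emdenExt_of_one_le hg hr.le]
  refine mul_neg_of_pos_of_neg (div_pos (by linarith [hg.dneg]) (by linarith)) ?_
  linarith [Real.rpow_lt_one_of_one_lt_of_neg hr (by linarith : 2 - (N : ℝ) < 0)]

lemma emdenExt_one (hg : IsEmdenProfile N p g) : emdenExt N g 1 = 0 := by
  rw [emdenExt_of_le_one zero_le_one le_rfl, hg.bdry]

lemma emdenExt_pos_iff (hg : IsEmdenProfile N p g) (hN : 3 ≤ N) {r : ℝ} (hr : 0 ≤ r) :
    0 < emdenExt N g r ↔ r < 1 := by
  refine ⟨fun h => ?_, fun h => ?_⟩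
  · by_contra! hcon
    exact absurd h (not_lt.2 (emdenExt_nonpos hg hN hcon))
  · rw [emdenExt_of_le_one hr h.le]
    exact hg.pos_Ico (by omega) ⟨hr, h⟩

lemma emdenExt_neg_iff (hg : IsEmdenProfile N p g) (hN : 3 ≤ N) {r : ℝ} (hr : 0 ≤ r) :
    emdenExt N g r < 0 ↔ 1 < r := by
  refine ⟨fun h => ?_, emdenExt_neg hg hN⟩
  by_contra! hcon
  rcases hcon.lt_or_eq with h1 | h1
  · exact absurd h ((emdenExt_pos_iff hg hN hr).2 h1).not_gt
  · rw [h1, emdenExt_one hg] at h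
    exact lt_irrefl _ h

end Scaled

section Main

variable {N : ℕ} {p : ℝ} {g : ℝ → ℝ}

lemma emdenScaledMass_inv (hg : IsEmdenProfile N p g) (hN : 3 ≤ N) (hp : 1 < p) :
    emdenScaledMass N p g (RN N) (RN N)⁻¹ = Istar N p g := by
  have hR := RN_pos N
  have hN' : (N : ℝ) ≠ 0 := by exact_mod_cast (by omega : N ≠ 0)
  have hp1 : p - 1 ≠ 0 := by linarith
  rw [emdenScaledMass, Istar, Ipval, inv_mul_cancel₀ hR.ne',
    emdenMass_of_one_le hg hN hp le_rfl, Real.inv_rpow hR.le,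
    show (N : ℝ) / (p - 1) * (1 - p * ((N : ℝ) - 2) / N) = 2 * p / (p - 1) - N by
      field_simp; ring]
  ring

lemma Istar_pos (hg : IsEmdenProfile N p g) (hN : 3 ≤ N) : 0 < Istar N p g := by
  have hNpos : (0 : ℝ) < N := by exact_mod_cast (by omega : 0 < N)
  exact div_pos (mul_pos (mul_pos hNpos (omegaN_pos N)) (by linarith [hg.dneg]))
    (Real.rpow_pos_of_pos (RN_pos N) _)

lemma exists_unique_isFBSol (hg : IsEmdenProfile N p g) (hN : 3 ≤ N) (hp : 1 < p)
    (hpN : p < (N : ℝ) / ((N : ℝ) - 2)) {R I : ℝ} (hR : 0 < R) (hI : 0 < I) :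
    ∃ γ v, IsFBSol (ball (0 : EuclideanSpace ℝ (Fin N)) R) p I γ v ∧
      ∀ γ' v', IsFBSol (ball (0 : EuclideanSpace ℝ (Fin N)) R) p I γ' v' →
        γ' = γ ∧ EqOn v' v (closedBall 0 R) := by
  obtain ⟨μ, hμ, rfl⟩ := emdenScaledMass_surj hg hN hp hpN hR hI
  refine ⟨_, _, isFBSol_emdenScaled hg hN hp hR hμ, fun γ' v' hv' => ?_⟩
  obtain ⟨ν, hν, hv, hγ, hm⟩ := hv'.exists_emdenScaled hg hN hp hR hI
  obtain rfl : μ = ν := (emdenScaledMass_strictMonoOn hg hN hp hpN hR).injOn hμ hν hm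
  exact ⟨hγ, hv⟩

lemma pos_mul_neg_iff {a t : ℝ} (ha : 0 < a) : a * t < 0 ↔ t < 0 :=
  smul_neg_iff_of_pos_left ha

lemma IsFBSol.sign_boundary (hg : IsEmdenProfile N p g) (hN : 3 ≤ N) (hp : 1 < p)
    (hpN : p < (N : ℝ) / ((N : ℝ) - 2)) {I γ : ℝ} (hI : 0 < I)
    {v : EuclideanSpace ℝ (Fin N) → ℝ}
    (hv : IsFBSol (ball (0 : EuclideanSpace ℝ (Fin N)) (RN N)) p I γ v) :
    (0 < γ ↔ I < Istar N p g) ∧ (γ < 0 ↔ Istar N p g < I) := by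
  have hR := RN_pos N
  obtain ⟨μ, hμ, -, rfl, rfl⟩ := hv.exists_emdenScaled hg hN hp hR hI
  have hmono := emdenScaledMass_strictMonoOn hg hN hp hpN hR
  have ha : 0 < μ ^ (2 / (p - 1)) := Real.rpow_pos_of_pos hμ _
  have hi : (RN N)⁻¹ ∈ Ioi (0 : ℝ) := inv_pos.2 hR
  rw [← emdenScaledMass_inv hg hN hp, hmono.lt_iff_lt hμ hi, hmono.lt_iff_lt hi hμ,
    mul_pos_iff_of_pos_left ha, emdenExt_pos_iff hg hN (mul_pos hμ hR).le,
    pos_mul_neg_iff ha, emdenExt_neg_iff hg hN (mul_pos hμ hR).le,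
    ← one_div, lt_div_iff₀ hR, div_lt_iff₀ hR]
  exact ⟨Iff.rfl, Iff.rfl⟩

lemma IsFBSol.boundary_eq (hg : IsEmdenProfile N p g) (hN : 3 ≤ N) (hp : 1 < p)
    (hpN : p < (N : ℝ) / ((N : ℝ) - 2)) {I γ : ℝ} (hI : Istar N p g < I)
    {v : EuclideanSpace ℝ (Fin N) → ℝ}
    (hv : IsFBSol (ball (0 : EuclideanSpace ℝ (Fin N)) (RN N)) p I γ v) :
    γ = cN N * I * (1 - (I / Istar N p g) ^ (((N : ℝ) - 2) / (2 * p / (p - 1) - N))) := by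
  have hR := RN_pos N
  have hI0 := (Istar_pos hg hN).trans hI
  have hκ := scaling_exponent_pos hN hp hpN
  have hneg := (hv.sign_boundary hg hN hp hpN hI0).2.2 hI
  have hN' : (3 : ℝ) ≤ N := by exact_mod_cast hN
  have hω := omegaN_pos N
  have hp1 : p - 1 ≠ 0 := by linarith
  obtain ⟨μ, hμ, -, rfl, rfl⟩ := hv.exists_emdenScaled hg hN hp hR hI0
  have hμR := mul_pos hμ hR
  rw [pos_mul_neg_iff (Real.rpow_pos_of_pos hμ _), emdenExt_neg_iff hg hN hμR.le] at hneg
  have hK : 0 < -deriv g 1 := by linarith [hg.dneg]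
  have hratio : emdenScaledMass N p g (RN N) μ / Istar N p g =
      (μ * RN N) ^ (2 * p / (p - 1) - N) := by
    rw [← emdenScaledMass_inv hg hN hp, emdenScaledMass, emdenScaledMass,
      inv_mul_cancel₀ hR.ne', emdenMass_of_one_le hg hN hp le_rfl,
      emdenMass_of_one_le hg hN hp hneg.le, Real.inv_rpow hR.le, Real.mul_rpow hμ.le hR.le]
    have := Real.rpow_pos_of_pos hR (2 * p / (p - 1) - N)
    have := hg.dneg.ne
    field_simp
  rw [hratio, ← Real.rpow_mul hμR.le, mul_div_cancel₀ _ hκ.ne', emdenExt_of_one_le hg hneg.le,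
    emdenScaledMass, emdenMass_of_one_le hg hN hp hneg.le, cN,
    show 2 / (p - 1) = (2 * p / (p - 1) - N) + ((N : ℝ) - 2) by field_simp; ring,
    Real.rpow_add hμ, show 2 - (N : ℝ) = -((N : ℝ) - 2) by ring, Real.rpow_neg hμR.le,
    Real.mul_rpow hμ.le hR.le]
  have h1 := Real.rpow_pos_of_pos hμ ((N : ℝ) - 2)
  have h2 := Real.rpow_pos_of_pos hR ((N : ℝ) - 2)
  have h3 : (N : ℝ) - 2 ≠ 0 := by linarith
  field_simp

section Equivalence

variable {Ω : Set (EuclideanSpace ℝ (Fin N))} {lam : ℝ}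

lemma rpow_inv_rpow_exponent (hp : 1 < p) (hl : 0 < lam) :
    (lam ^ (1 / (p - 1))) ^ p = lam ^ (p / (p - 1)) ∧
      lam ^ (p / (p - 1)) = lam ^ (1 / (p - 1)) * lam := by
  have hp1 : p - 1 ≠ 0 := by linarith
  constructor
  · rw [← Real.rpow_mul hl.le]
    congr 1
    ring
  · rw [← Real.rpow_add_one hl.ne']
    congr 1
    field_simp
    ring

lemma IsSol.isFBSol (hΩ : IsOpen Ω) (hp : 1 < p) (hl : 0 < lam) {α : ℝ}
    {ψ : EuclideanSpace ℝ (Fin N) → ℝ} (h : IsSol Ω p lam α ψ) :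
    IsFBSol Ω p (lam ^ (p / (p - 1))) (lam ^ (1 / (p - 1)) * α)
      (fun x => lam ^ (1 / (p - 1)) * (α + lam * ψ x)) := by
  obtain ⟨e1, e2⟩ := rpow_inv_rpow_exponent hp hl
  have hb := Real.rpow_nonneg hl.le (1 / (p - 1))
  refine ⟨?_, ?_, fun x hx => ?_, fun x hx => ?_, ?_⟩
  · exact continuousOn_const.mul (continuousOn_const.add (continuousOn_const.mul h.contOn))
  · exact contDiffOn_const.mul (contDiffOn_const.add (contDiffOn_const.mul h.smooth))
  · have hψ := h.smooth.contDiffAt (hΩ.mem_nhds hx)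
    have hl1 : ContDiffAt ℝ 2 (fun y => lam * ψ y) x := contDiffAt_const.mul hψ
    have h1 := lap_const_mul (lam ^ (1 / (p - 1))) ((contDiffAt_const (c := α)).add hl1)
    have h2 := lap_add (contDiffAt_const (c := α)) hl1
    have h3 := lap_const_mul lam hψ
    rw [lap_const, zero_add, h3] at h2
    have h4 : lap (fun x => lam ^ (1 / (p - 1)) * (α + lam * ψ x)) x =
        lam ^ (1 / (p - 1)) * (lam * lap ψ x) := h1.trans (by rw [← h2])
    rw [h4, posPart_mul_rpow hb, ← h.pde x hx, e1, e2]
    ring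
  · simp only [h.bdry x hx, mul_zero, add_zero]
  · simp_rw [posPart_mul_rpow hb]
    rw [integral_const_mul, h.constr, mul_one, e1]

lemma IsFBSol.isSol (hΩ : IsOpen Ω) (hp : 1 < p) (hl : 0 < lam) {γ : ℝ}
    {v : EuclideanSpace ℝ (Fin N) → ℝ} (h : IsFBSol Ω p (lam ^ (p / (p - 1))) γ v) :
    IsSol Ω p lam ((lam ^ (1 / (p - 1)))⁻¹ * γ)
      (fun x => (lam ^ (p / (p - 1)))⁻¹ * (v x - γ)) := by
  obtain ⟨e1, e2⟩ := rpow_inv_rpow_exponent hp hl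
  have hb := Real.rpow_pos_of_pos hl (1 / (p - 1))
  have hI := Real.rpow_pos_of_pos hl (p / (p - 1))
  have hF : ∀ x, max ((lam ^ (1 / (p - 1)))⁻¹ * γ + lam * ((lam ^ (p / (p - 1)))⁻¹ * (v x - γ))) 0
      ^ p = (lam ^ (p / (p - 1)))⁻¹ * max (v x) 0 ^ p := fun x => by
    rw [← e1, ← Real.inv_rpow hb.le, ← posPart_mul_rpow (inv_nonneg.2 hb.le), Real.inv_rpow hb.le,
      e1, e2]
    congr 2
    field_simp
    ring
  refine ⟨?_, ?_, fun x hx => ?_, fun x hx => ?_, ?_⟩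
  · exact continuousOn_const.mul (h.contOn.sub continuousOn_const)
  · exact contDiffOn_const.mul (h.smooth.sub contDiffOn_const)
  · have hv := h.smooth.contDiffAt (hΩ.mem_nhds hx)
    have h1 := lap_const_mul (lam ^ (p / (p - 1)))⁻¹ (hv.sub (contDiffAt_const (c := γ)))
    have h2 := lap_sub hv (contDiffAt_const (c := γ))
    rw [lap_const, sub_zero] at h2
    have h4 : lap (fun x => (lam ^ (p / (p - 1)))⁻¹ * (v x - γ)) x =
        (lam ^ (p / (p - 1)))⁻¹ * lap v x := h1.trans (by rw [← h2])
    rw [h4, hF, ← h.pde x hx]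
    ring
  · simp only [h.bdry x hx, sub_self, mul_zero]
  · simp_rw [hF]
    rw [integral_const_mul, h.constr, inv_mul_cancel₀ hI.ne']

end Equivalence

lemma lamStarBall_pos (hg : IsEmdenProfile N p g) (hN : 3 ≤ N) : 0 < lamStarBall N p g :=
  Real.rpow_pos_of_pos (Istar_pos hg hN) _

lemma lamStarBall_rpow (hg : IsEmdenProfile N p g) (hN : 3 ≤ N) (hp : 1 < p) :
    lamStarBall N p g ^ (p / (p - 1)) = Istar N p g := by
  have hp1 : p - 1 ≠ 0 := by linarith
  have hp0 : p ≠ 0 := by linarith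
  rw [lamStarBall, ← Real.rpow_mul (Istar_pos hg hN).le,
    show (p - 1) / p * (p / (p - 1)) = 1 by field_simp, Real.rpow_one]

lemma exists_unique_isSol (hg : IsEmdenProfile N p g) (hN : 3 ≤ N) (hp : 1 < p)
    (hpN : p < (N : ℝ) / ((N : ℝ) - 2)) {R lam : ℝ} (hR : 0 < R) (hl : 0 < lam) :
    ∃ α ψ, IsSol (ball (0 : EuclideanSpace ℝ (Fin N)) R) p lam α ψ ∧
      ∀ α' ψ', IsSol (ball (0 : EuclideanSpace ℝ (Fin N)) R) p lam α' ψ' →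
        α' = α ∧ EqOn ψ' ψ (closedBall 0 R) := by
  have hI := Real.rpow_pos_of_pos hl (p / (p - 1))
  have hb := Real.rpow_pos_of_pos hl (1 / (p - 1))
  obtain ⟨γ, v, hv, huniq⟩ := exists_unique_isFBSol hg hN hp hpN hR hI
  refine ⟨_, _, hv.isSol isOpen_ball hp hl, fun α' ψ' h' => ?_⟩
  obtain ⟨h1, h2⟩ := huniq _ _ (h'.isFBSol isOpen_ball hp hl)
  refine ⟨by rw [← h1]; field_simp, fun x hx => ?_⟩
  have h3 := h2 hx
  simp only at h3 ⊢
  rw [← h3, ← h1, (rpow_inv_rpow_exponent hp hl).2]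
  field_simp
  ring

lemma lt_lamStarBall_iff (hg : IsEmdenProfile N p g) (hN : 3 ≤ N) (hp : 1 < p) {lam : ℝ}
    (hl : 0 < lam) :
    (lam ^ (p / (p - 1)) < Istar N p g ↔ lam < lamStarBall N p g) ∧
      (Istar N p g < lam ^ (p / (p - 1)) ↔ lamStarBall N p g < lam) := by
  have hq : 0 < p / (p - 1) := div_pos (by linarith) (by linarith)
  have hs := (lamStarBall_pos hg hN).le
  rw [← lamStarBall_rpow hg hN hp, Real.rpow_lt_rpow_iff hl.le hs hq,
    Real.rpow_lt_rpow_iff hs hl.le hq]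
  exact ⟨Iff.rfl, Iff.rfl⟩

lemma IsSol.sign_boundary (hg : IsEmdenProfile N p g) (hN : 3 ≤ N) (hp : 1 < p)
    (hpN : p < (N : ℝ) / ((N : ℝ) - 2)) {lam α : ℝ} (hl : 0 < lam)
    {ψ : EuclideanSpace ℝ (Fin N) → ℝ}
    (h : IsSol (ball (0 : EuclideanSpace ℝ (Fin N)) (RN N)) p lam α ψ) :
    (0 < α ↔ lam < lamStarBall N p g) ∧ (α < 0 ↔ lamStarBall N p g < lam) := by
  have hb := Real.rpow_pos_of_pos hl (1 / (p - 1))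
  have hs := (h.isFBSol isOpen_ball hp hl).sign_boundary hg hN hp hpN
    (Real.rpow_pos_of_pos hl _)
  rwa [mul_pos_iff_of_pos_left hb, pos_mul_neg_iff hb, (lt_lamStarBall_iff hg hN hp hl).1,
    (lt_lamStarBall_iff hg hN hp hl).2] at hs

lemma IsSol.boundary_eq (hg : IsEmdenProfile N p g) (hN : 3 ≤ N) (hp : 1 < p)
    (hpN : p < (N : ℝ) / ((N : ℝ) - 2)) {lam α : ℝ} (hlam : lamStarBall N p g < lam)
    {ψ : EuclideanSpace ℝ (Fin N) → ℝ}
    (h : IsSol (ball (0 : EuclideanSpace ℝ (Fin N)) (RN N)) p lam α ψ) :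
    α = cN N * lam *
      (1 - (lam / lamStarBall N p g) ^ (p / ((N : ℝ) / ((N : ℝ) - 2) - p))) := by
  have hs := lamStarBall_pos hg hN
  have hl := hs.trans hlam
  have hb := Real.rpow_pos_of_pos hl (1 / (p - 1))
  have hN' : (3 : ℝ) ≤ N := by exact_mod_cast hN
  have hkey := (h.isFBSol isOpen_ball hp hl).boundary_eq hg hN hp hpN
    ((lt_lamStarBall_iff hg hN hp hl).2.2 hlam)
  have hexp : p / (p - 1) * (((N : ℝ) - 2) / (2 * p / (p - 1) - N)) =
      p / ((N : ℝ) / ((N : ℝ) - 2) - p) := by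
    have h1 : p - 1 ≠ 0 := by linarith
    have h2 : (N : ℝ) - 2 ≠ 0 := by linarith
    have h3 := (scaling_exponent_pos hN hp hpN).ne'
    have h4 : (N : ℝ) / ((N : ℝ) - 2) - p ≠ 0 := by linarith
    rw [div_mul_div_comm, div_eq_div_iff (mul_ne_zero h1 h3) h4]
    field_simp
    ring
  rw [← lamStarBall_rpow hg hN hp, ← Real.div_rpow hl.le hs.le,
    ← Real.rpow_mul (div_pos hl hs).le, hexp, (rpow_inv_rpow_exponent hp hl).2] at hkey
  exact mul_left_cancel₀ hb.ne' (hkey.trans (by ring))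

end Main

/-- Theorem 9.1: uniqueness on balls for `N ≥ 3`, `p ∈ (1, N/(N-2))`. On the ball
`𝔻_N` of unit volume, for every `I > 0` (equivalently `λ > 0`) there is a unique solution
of `(F)_I` (of `(P)_λ`); the solution is positive iff `I < I*(𝔻_N,p)` (iff
`λ < λ*(𝔻_N,p)`), the free boundary is nonempty iff `I > I*(𝔻_N,p)` (iff
`λ > λ*(𝔻_N,p)`), and for `λ > λ*(𝔻_N,p)` one has
`α_λ = c_N λ(1 - (λ/λ*)^{p/(p_N - p)})`. -/
theorem statement19 (N : ℕ) (hN : 3 ≤ N)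
    (p : ℝ) (hp : 1 < p) (hpN : p < (N : ℝ) / ((N : ℝ) - 2))
    (g : ℝ → ℝ) (hg : IsEmdenProfile N p g) :
    -- unique solvability of `(F)_I` for all `I > 0`
    (∀ I : ℝ, 0 < I → ∃ γ v,
      IsFBSol (ball (0 : EuclideanSpace ℝ (Fin N)) (RN N)) p I γ v ∧
      ∀ γ' v', IsFBSol (ball (0 : EuclideanSpace ℝ (Fin N)) (RN N)) p I γ' v' →
        γ' = γ ∧ Set.EqOn v' v (closedBall 0 (RN N))) ∧
    -- unique solvability of `(P)_λ` for all `λ > 0`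
    (∀ lam : ℝ, 0 < lam → ∃ α ψ,
      IsSol (ball (0 : EuclideanSpace ℝ (Fin N)) (RN N)) p lam α ψ ∧
      ∀ α' ψ', IsSol (ball (0 : EuclideanSpace ℝ (Fin N)) (RN N)) p lam α' ψ' →
        α' = α ∧ Set.EqOn ψ' ψ (closedBall 0 (RN N))) ∧
    -- positivity / nonempty free boundary dichotomy for `(F)_I`
    (∀ I : ℝ, 0 < I → ∀ γ v,
      IsFBSol (ball (0 : EuclideanSpace ℝ (Fin N)) (RN N)) p I γ v →
        (0 < γ ↔ I < Istar N p g) ∧ (γ < 0 ↔ Istar N p g < I)) ∧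
    -- positivity / nonempty free boundary dichotomy for `(P)_λ`
    (∀ lam : ℝ, 0 < lam → ∀ α ψ,
      IsSol (ball (0 : EuclideanSpace ℝ (Fin N)) (RN N)) p lam α ψ →
        (0 < α ↔ lam < lamStarBall N p g) ∧ (α < 0 ↔ lamStarBall N p g < lam)) ∧
    -- the explicit value of `α_λ` beyond the threshold
    (∀ lam : ℝ, lamStarBall N p g < lam → ∀ α ψ,
      IsSol (ball (0 : EuclideanSpace ℝ (Fin N)) (RN N)) p lam α ψ →
        α = cN N * lam *
          (1 - (lam / lamStarBall N p g) ^ (p / ((N : ℝ) / ((N : ℝ) - 2) - p)))) := by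
  have hR := RN_pos N
  exact ⟨fun I hI => exists_unique_isFBSol hg hN hp hpN hR hI,
    fun lam hl => exists_unique_isSol hg hN hp hpN hR hl,
    fun I hI γ v hv => hv.sign_boundary hg hN hp hpN hI,
    fun lam hl α ψ h => h.sign_boundary hg hN hp hpN hl,
    fun lam hl α ψ h => h.boundary_eq hg hN hp hpN hl⟩
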